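/- arXiv:1211.4535 — 3 statements merged into one kernel-verified Lean document; each statement's English description precedes it below -/
import Mathlib

section
/- Let X ⊆ ℂ be bounded, V a simply connected open neighborhood of the closure of X, and g : V → ℂ a holomorphic injective map. Then the hat of g(X) equals g(X̂), i.e., \widehat{g(X)} = g(X̂). -/
open Set Topology Bornology Filter Metric

noncomputable section

/-- The "hat" of a bounded set: its closure together with all bounded connected
components of the complement of its closure. -/
def hat (X : Set ℂ) : Set ℂ :=
  closure X ∪ {z | z ∉ closure X ∧ IsBounded (connectedComponentIn (closure X)ᶜ z)}

/-- The ω-limit set of the orbit of `x` under `f`. -/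
def omegaSet (f : ℂ → ℂ) (x : ℂ) : Set ℂ :=
  {y | MapClusterPt y atTop fun n => f^[n] x}

/-- `v` is a singular value of `f`: on no open neighborhood of `v` are all branches of
the inverse well defined and univalent. -/
def IsSingularValue (f : ℂ → ℂ) (v : ℂ) : Prop :=
  ∀ V : Set ℂ, IsOpen V → v ∈ V →
    ∃ x ∈ f ⁻¹' V, ¬ (Set.InjOn f (connectedComponentIn (f ⁻¹' V) x) ∧
      f '' connectedComponentIn (f ⁻¹' V) x = V)

/-- The Fatou set: points near which the family of iterates is normal (equicontinuous). -/
def fatouSet (f : ℂ → ℂ) : Set ℂ :=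
  {z | ∃ U ∈ 𝓝 z, IsOpen U ∧ EquicontinuousOn (fun n : ℕ => f^[n]) U}

/-- `φ` is a biholomorphism from `A` onto `B`. -/
def Biholo (φ : ℂ → ℂ) (A B : Set ℂ) : Prop :=
  DifferentiableOn ℂ φ A ∧ Set.InjOn φ A ∧ φ '' A = B

/-- `Δ` is a forward invariant Siegel disk of `f` with rotation number `θ`. -/
def IsSiegelDisk (f : ℂ → ℂ) (Δ : Set ℂ) (θ : ℝ) : Prop :=
  IsOpen Δ ∧ IsConnected Δ ∧ f '' Δ = Δ ∧ Δ ⊆ fatouSet f ∧ Irrational θ ∧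
  ∃ φ : ℂ → ℂ, Biholo φ (Metric.ball 0 1) Δ ∧
    ∀ z ∈ Metric.ball (0:ℂ) 1,
      f (φ z) = φ (Complex.exp (2 * Real.pi * θ * Complex.I) * z)

/-- `U` is a connected component of the Fatou set of `f`. -/
def IsFatouComponent (f : ℂ → ℂ) (U : Set ℂ) : Prop :=
  ∃ z ∈ fatouSet f, U = connectedComponentIn (fatouSet f) z

/-- A periodic Fatou component. -/
def IsPeriodicFatouComponent (f : ℂ → ℂ) (U : Set ℂ) : Prop :=
  IsFatouComponent f U ∧ ∃ n : ℕ, 0 < n ∧ f^[n] '' U ⊆ U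

/-- The Separation Property: closures of any two distinct periodic Fatou components
intersect in at most one point. -/
def SeparationProperty (f : ℂ → ℂ) : Prop :=
  ∀ U V : Set ℂ, IsPeriodicFatouComponent f U → IsPeriodicFatouComponent f V →
    U ≠ V → (closure U ∩ closure V).Subsingleton

/-- A wandering domain: a Fatou component whose forward images lie in pairwise
distinct Fatou components. -/
def IsWanderingDomain (f : ℂ → ℂ) (U : Set ℂ) : Prop :=
  IsFatouComponent f U ∧
  ∀ m n : ℕ, m < n → ∀ z ∈ U,
    connectedComponentIn (fatouSet f) (f^[m] z) ≠ connectedComponentIn (fatouSet f) (f^[n] z)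

/-- Only the finite set `S` of singular values interacts with the Siegel disk `Δ`. -/
def InteractingSingularSet (f : ℂ → ℂ) (Δ : Set ℂ) (S : Set ℂ) : Prop :=
  S.Finite ∧ S ⊆ {v | IsSingularValue f v} ∧
  (∀ s ∈ S, (omegaSet f s ∩ hat Δ).Nonempty) ∧
  closure (⋃ s ∈ {v | IsSingularValue f v} \ S, omegaSet f s) ∩ hat Δ = ∅ ∧
  closure ({v | IsSingularValue f v} \ S) ∩ frontier Δ = ∅

/-- `θ` is a Herman number: every analytic orientation preserving circle diffeomorphism
(given by its lift) with rotation number `θ` is analytically linearizable. -/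
def IsHermanNumber (θ : ℝ) : Prop :=
  ∀ F : ℝ → ℝ, AnalyticOnNhd ℝ F Set.univ → StrictMono F →
    (∀ x, F (x + 1) = F x + 1) → (∀ x, 0 < deriv F x) →
    (∀ x : ℝ, Filter.Tendsto (fun n : ℕ => (F^[n] x - x) / n) Filter.atTop (nhds θ)) →
    ∃ H : ℝ → ℝ, AnalyticOnNhd ℝ H Set.univ ∧ StrictMono H ∧
      (∀ x, H (x + 1) = H x + 1) ∧ ∀ x, H (F x) = H x + θ

/-- `f` restricted to `U` is a holomorphic covering of `V`. -/
def IsHolCoveringOn (f : ℂ → ℂ) (U V : Set ℂ) : Prop :=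
  DifferentiableOn ℂ f U ∧ f '' U = V ∧
  ∀ v ∈ V, ∃ W, IsOpen W ∧ v ∈ W ∧ W ⊆ V ∧
    ∀ x ∈ U ∩ f ⁻¹' W, Set.BijOn f (connectedComponentIn (U ∩ f ⁻¹' W) x) W

/-- There is no continuous branch of `log (z - c)` on a circle centered at `c`. -/
theorem not_continuousOn_log_sub_circle {c : ℂ} {R : ℝ} (hR : 0 < R) {f : ℂ → ℂ}
    (hf : ContinuousOn f (sphere c R)) (hexp : ∀ z ∈ sphere c R, Complex.exp (f z) = z - c) :
    False := by
  set φ : ℝ → ℂ := fun t => f (circleMap c R t) - t * Complex.I with hφ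
  have hmem : ∀ t, circleMap c R t ∈ sphere c R := circleMap_mem_sphere c hR.le
  have hcont : Continuous φ :=
    (hf.comp_continuous (continuous_circleMap c R) hmem).sub (by fun_prop)
  have hval : φ '' univ ⊆ Complex.exp ⁻¹' {(R : ℂ)} := by
    rintro _ ⟨t, -, rfl⟩
    simp only [mem_preimage, mem_singleton_iff, hφ, Complex.exp_sub, hexp _ (hmem t)]
    simp [circleMap]
  have hsub : (φ '' univ).Subsingleton :=
    (countable_singleton (R : ℂ)).preimage_cexp.isTotallyDisconnected _ hval
      (isPreconnected_univ.image φ hcont.continuousOn)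
  have heq : φ (2 * Real.pi) = φ 0 :=
    hsub (mem_image_of_mem φ (mem_univ _)) (mem_image_of_mem φ (mem_univ _))
  have hper : circleMap c R (2 * Real.pi) = circleMap c R 0 := by
    simpa using periodic_circleMap c R 0
  simp [hφ, hper, Real.pi_ne_zero] at heq

theorem closure_connectedComponentIn_inter_subset {α : Type*} [TopologicalSpace α] (F : Set α)
    (x : α) : closure (connectedComponentIn F x) ∩ F ⊆ connectedComponentIn F x := by
  by_cases hx : x ∈ F
  · exact (isPreconnected_connectedComponentIn.subset_closure
      (subset_inter subset_closure (connectedComponentIn_subset F x))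
      inter_subset_left).subset_connectedComponentIn
      ⟨subset_closure (mem_connectedComponentIn hx), hx⟩ inter_subset_right
  · simp [connectedComponentIn_eq_empty hx]

/-- Easy half of Borsuk's criterion: if `c` lies in a bounded component of the complement of a
closed set `K`, then `z - c` has no continuous logarithm on `K`. -/
theorem not_continuousOn_log_sub_of_isBounded {K : Set ℂ} (hK : IsClosed K) {c : ℂ} (hc : c ∉ K)
    (hb : IsBounded (connectedComponentIn Kᶜ c)) {f : ℂ → ℂ} (hf : ContinuousOn f K)
    (hexp : ∀ z ∈ K, Complex.exp (f z) = z - c) : False := by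
  classical
  set U := connectedComponentIn Kᶜ c with hU
  have hUo : IsOpen U := hK.isOpen_compl.connectedComponentIn
  have hcU : c ∈ U := mem_connectedComponentIn hc
  obtain ⟨F, hF⟩ := ContinuousMap.exists_restrict_eq hK ⟨_, hf.domRestrict⟩
  have hFK : ∀ z ∈ K, F z = f z := fun z hz => congr($hF ⟨z, hz⟩)
  have hfr : frontier U ⊆ K := by
    intro z hz
    by_contra hzK
    rw [hUo.frontier_eq] at hz
    exact hz.2 (closure_connectedComponentIn_inter_subset _ _ ⟨hz.1, hzK⟩)
  set h : ℂ → ℂ := U.piecewise (fun z => Complex.exp (F z)) (fun z => z - c) with hh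
  have hcont : Continuous h :=
    Continuous.piecewise (fun z hz => by rw [hFK z (hfr hz), hexp z (hfr hz)])
      (Complex.continuous_exp.comp F.continuous) (by fun_prop)
  have hne : (0 : ℂ) ∉ h '' univ := by
    rintro ⟨z, -, hz⟩
    by_cases hzU : z ∈ U
    · simp [hh, hzU] at hz
    · rw [hh, piecewise_eq_of_notMem _ _ _ hzU, sub_eq_zero] at hz
      exact hzU (hz ▸ hcU)
  have hsc : IsSimplyConnected (univ : Set ℂ) := by
    simpa using (IsEmbedding.id.isSimplyConnected_image (s := (univ : Set ℂ))).2
      ((Homeomorph.Set.univ ℂ).toHomotopyEquiv.simplyConnectedSpace_iff.2 inferInstance)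
  obtain ⟨L, hL, hLexp⟩ :=
    Complex.exists_continuousOn_eqOn_exp_comp hsc isOpen_univ hcont.continuousOn hne
  obtain ⟨R, hR, hUR⟩ := hb.subset_ball_lt 0 c
  refine not_continuousOn_log_sub_circle (c := c) hR (hL.mono (subset_univ _)) fun z hz => ?_
  have hzU : z ∉ U := fun hzU => (mem_ball.1 (hUR hzU)).ne (mem_sphere.1 hz)
  simpa [hh, hzU] using hLexp (mem_univ z)

theorem hat_subset_of_isSimplyConnected {X V : Set ℂ} (hV : IsOpen V) (hVsc : IsSimplyConnected V)
    (hXV : closure X ⊆ V) : hat X ⊆ V := by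
  rintro c (hc | ⟨hc, hb⟩)
  · exact hXV hc
  · by_contra hcV
    obtain ⟨f, hf, hexp⟩ := Complex.exists_continuousOn_eqOn_exp_comp hVsc hV
      (g := fun z => z - c) (by fun_prop) (by
        rintro ⟨z, hz, hz0⟩
        exact hcV (sub_eq_zero.1 hz0 ▸ hz))
    exact not_continuousOn_log_sub_of_isBounded isClosed_closure hc hb (hf.mono hXV)
      fun z hz => hexp (hXV hz)

theorem OpenPartialHomeomorph.closure_image {X : Set ℂ} (hX : IsBounded X)
    (e : OpenPartialHomeomorph ℂ ℂ) (hXe : closure X ⊆ e.source) :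
    closure (e '' X) = e '' closure X := by
  have hc : ContinuousOn e (closure X) := e.continuousOn.mono hXe
  exact (closure_minimal (image_mono subset_closure)
    (hX.isCompact_closure.image_of_continuousOn hc).isClosed).antisymm hc.image_closure

theorem OpenPartialHomeomorph.image_hat_subset {X : Set ℂ} (hX : IsBounded X)
    (e : OpenPartialHomeomorph ℂ ℂ) (hsc : IsSimplyConnected e.source)
    (hXe : closure X ⊆ e.source) : e '' hat X ⊆ hat (e '' X) := by
  have hhat := hat_subset_of_isSimplyConnected e.open_source hsc hXe
  have hcl := e.closure_image hX hXe
  rintro _ ⟨z, hz | ⟨hz, hb⟩, rfl⟩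
  · exact Or.inl (hcl ▸ mem_image_of_mem e hz)
  set U := connectedComponentIn (closure X)ᶜ z with hU
  have hzU : z ∈ U := mem_connectedComponentIn hz
  have hUX : U ⊆ (closure X)ᶜ := connectedComponentIn_subset _ _
  have hUe : U ⊆ e.source := fun w hw =>
    hhat (Or.inr ⟨hUX hw, connectedComponentIn_eq hw ▸ hb⟩)
  have hclU : closure U ⊆ closure X ∪ U := fun w hw => by
    by_cases hwX : w ∈ closure X
    · exact Or.inl hwX
    · exact Or.inr (closure_connectedComponentIn_inter_subset _ _ ⟨hw, hwX⟩)
  have hzX : e z ∉ closure (e '' X) := by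
    rw [hcl]
    rintro ⟨w, hw, hwz⟩
    exact hz (e.injOn (hXe hw) (hUe hzU) hwz ▸ hw)
  have hclUe : closure U ⊆ e.source := hclU.trans (union_subset hXe hUe)
  have hopen : IsOpen (e '' U) :=
    e.isOpen_image_of_subset_source isClosed_closure.isOpen_compl.connectedComponentIn hUe
  have hbU : IsBounded (e '' U) :=
    (hb.isCompact_closure.image_of_continuousOn (e.continuousOn.mono hclUe)).isBounded.subset
      (image_mono subset_closure)
  refine Or.inr ⟨hzX, hbU.subset ?_⟩
  refine isPreconnected_connectedComponentIn.subset_of_closure_inter_subset hopen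
    ⟨e z, mem_connectedComponentIn hzX, mem_image_of_mem e hzU⟩ ?_
  rw [e.closure_image hb hclUe]
  rintro _ ⟨⟨w, hw, rfl⟩, hwX⟩
  exact (hclU hw).elim
    (fun h => absurd (hcl ▸ mem_image_of_mem e h) (connectedComponentIn_subset _ _ hwX))
    (mem_image_of_mem e)

theorem OpenPartialHomeomorph.hat_image {X : Set ℂ} (hX : IsBounded X)
    (e : OpenPartialHomeomorph ℂ ℂ) (hsc : IsSimplyConnected e.source)
    (hXe : closure X ⊆ e.source) : hat (e '' X) = e '' hat X := by
  have hcl := e.closure_image hX hXe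
  have hXt : closure (e '' X) ⊆ e.target := by
    rw [hcl]
    exact (e.mapsTo.mono_left hXe).image_subset
  have hbX : IsBounded (e '' X) :=
    (hX.isCompact_closure.image_of_continuousOn (e.continuousOn.mono hXe)).isBounded.subset
      (image_mono subset_closure)
  have hsct : IsSimplyConnected e.target :=
    e.toHomeomorphSourceTarget.toHomotopyEquiv.simplyConnectedSpace_iff.1 hsc
  have hsymm : e.symm '' (e '' X) = X :=
    e.symm_image_image_of_subset_source (subset_closure.trans hXe)
  refine Subset.antisymm (fun w hw => ?_) (e.image_hat_subset hX hsc hXe)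
  have hwt : w ∈ e.target := hat_subset_of_isSimplyConnected e.open_target hsct hXt hw
  have := e.symm.image_hat_subset hbX hsct hXt (mem_image_of_mem _ hw)
  rw [hsymm] at this
  exact ⟨_, this, e.right_inv hwt⟩

/-- An injective holomorphic function on a connected open set is open there. -/
theorem DifferentiableOn.isOpen_image_of_injOn {g : ℂ → ℂ} {V : Set ℂ} (hV : IsOpen V)
    (hVc : IsPreconnected V) (hg : DifferentiableOn ℂ g V) (hginj : InjOn g V) {s : Set ℂ}
    (hs : s ⊆ V) (hso : IsOpen s) : IsOpen (g '' s) := by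
  rcases (hg.analyticOnNhd hV).is_constant_or_isOpen hVc with ⟨w, hw⟩ | h
  · have hsub : s.Subsingleton := fun x hx y hy =>
      hginj (hs hx) (hs hy) ((hw x (hs hx)).trans (hw y (hs hy)).symm)
    rcases hsub.eq_empty_or_singleton with rfl | ⟨x, rfl⟩
    · simp
    · exact absurd hso (not_isOpen_singleton x)
  · exact h s hs hso

/-- hats are preserved by univalent maps. -/
theorem stmt2 (X V : Set ℂ) (hX : IsBounded X) (hV : IsOpen V) (hXV : closure X ⊆ V)
    (hVsc : SimplyConnectedSpace V) (g : ℂ → ℂ) (hg : DifferentiableOn ℂ g V)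
    (hginj : Set.InjOn g V) :
    hat (g '' X) = g '' hat X := by
  have hopen : IsOpenMap (V.domRestrict g) := fun s hs => by
    rw [domRestrict_eq, image_comp]
    exact hg.isOpen_image_of_injOn hV
      (IsSimplyConnected.isPathConnected hVsc).isConnected.isPreconnected hginj
      (Subtype.coe_image_subset _ _) (hV.isOpenMap_subtype_val s hs)
  let e := OpenPartialHomeomorph.ofContinuousOpenRestrict (hginj.toPartialEquiv g V)
    hg.continuousOn hopen hV
  exact e.hat_image hX hVsc hXV
end
end

section
/- Let f be an entire function with a bounded forward invariant Siegel disk Δ, and let Δ_∞ denote the unbounded connected component of ℂ \ Δ̂. Then ∂Δ = ∂Δ_∞. -/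
open Set Topology Bornology Filter Metric

noncomputable section

/-- Boundary points of a connected component of an open set lie outside the open set. -/
lemma notMem_frontier_connectedComponentIn {U : Set ℂ} (hU : IsOpen U) {x y : ℂ}
    (hy : y ∈ U) : y ∉ frontier (connectedComponentIn U x) := by
  intro hfr
  have hyo : IsOpen (connectedComponentIn U y) := hU.connectedComponentIn
  obtain ⟨w, hwy, hwx⟩ := mem_closure_iff.1 (frontier_subset_closure hfr) _ hyo
    (mem_connectedComponentIn hy)
  have heq : connectedComponentIn U x = connectedComponentIn U y :=
    (connectedComponentIn_eq hwx).trans (connectedComponentIn_eq hwy).symm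
  rw [heq, hyo.frontier_eq] at hfr
  exact hfr.2 (mem_connectedComponentIn hy)

/-- Maximum principle: a bound for an entire function on `X` persists on `hat X`. -/
lemma norm_le_of_mem_hat {X : Set ℂ} {P : ℂ → ℂ} (hP : Differentiable ℂ P) {M : ℝ}
    (hM : ∀ z ∈ X, ‖P z‖ ≤ M) {z : ℂ} (hz : z ∈ hat X) : ‖P z‖ ≤ M := by
  have hcl : closure X ⊆ {z | ‖P z‖ ≤ M} :=
    closure_minimal hM (isClosed_le hP.continuous.norm continuous_const)
  rcases hz with hz | ⟨hz, hbd⟩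
  · exact hcl hz
  · refine Complex.norm_le_of_forall_mem_frontier_norm_le hbd hP.diffContOnCl
      (fun y hy => hcl (by_contra fun hyX => ?_)) (subset_closure (mem_connectedComponentIn hz))
    exact notMem_frontier_connectedComponentIn isClosed_closure.isOpen_compl hyX hy

lemma isPreconnected_setOf_lt_norm {R : ℝ} (hR : 0 < R) : IsPreconnected {z : ℂ | R < ‖z‖} := by
  have himage : {z : ℂ | R < ‖z‖} = Complex.exp '' {w | Real.log R < w.re} := by
    ext z
    constructor
    · intro hz
      have hz0 : z ≠ 0 := norm_pos_iff.1 (hR.trans hz)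
      refine ⟨Complex.log z, ?_, Complex.exp_log hz0⟩
      simpa [Complex.log_re] using Real.log_lt_log hR hz
    · rintro ⟨w, hw, rfl⟩
      simpa [Complex.norm_exp] using (Real.log_lt_iff_lt_exp hR).1 hw
  rw [himage]
  exact (convex_halfSpace_re_gt _).isPreconnected.image _ Complex.continuous_exp.continuousOn

/-- The complement of a bounded set has at most one unbounded component. -/
lemma connectedComponentIn_compl_eq_of_not_isBounded {X : Set ℂ} (hX : IsBounded X) {x y : ℂ}
    (hx : ¬ IsBounded (connectedComponentIn Xᶜ x)) (hy : ¬ IsBounded (connectedComponentIn Xᶜ y)) :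
    connectedComponentIn Xᶜ x = connectedComponentIn Xᶜ y := by
  obtain ⟨R, hR, hXR⟩ := hX.exists_pos_norm_le
  have hout : {z : ℂ | R < ‖z‖} ⊆ Xᶜ := fun z hz hzX => (hXR z hzX).not_gt hz
  have hsub : ∀ x, ¬ IsBounded (connectedComponentIn Xᶜ x) →
      {z : ℂ | R < ‖z‖} ⊆ connectedComponentIn Xᶜ x := by
    intro x hx
    obtain ⟨w, hw, hwR⟩ : ∃ w ∈ connectedComponentIn Xᶜ x, R < ‖w‖ := by
      by_contra! h
      exact hx (isBounded_iff_forall_norm_le.2 ⟨R, h⟩)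
    rw [connectedComponentIn_eq hw]
    exact (isPreconnected_setOf_lt_norm hR).subset_connectedComponentIn hwR hout
  have hmem : ((R + 1 : ℝ) : ℂ) ∈ {z : ℂ | R < ‖z‖} := by
    simp only [mem_ofPred_eq, Complex.norm_real, Real.norm_eq_abs]
    exact (lt_add_one R).trans_le (le_abs_self _)
  rw [connectedComponentIn_eq (hsub x hx hmem), connectedComponentIn_eq (hsub y hy hmem)]

/-- An unbounded component of the complement of `hat X` is a component of the complement of
`closure X`. -/
lemma connectedComponentIn_compl_hat {X : Set ℂ} {z : ℂ} (hz : z ∉ hat X) :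
    connectedComponentIn (hat X)ᶜ z = connectedComponentIn (closure X)ᶜ z := by
  refine (connectedComponentIn_mono z (compl_subset_compl.2 subset_union_left)).antisymm ?_
  have hzX : z ∉ closure X := fun h => hz (Or.inl h)
  refine isPreconnected_connectedComponentIn.subset_connectedComponentIn
    (mem_connectedComponentIn hzX) ?_
  rintro w hw (hwX | ⟨-, hwb⟩)
  · exact connectedComponentIn_subset _ _ hw hwX
  · exact hz (Or.inr ⟨hzX, connectedComponentIn_eq hw ▸ hwb⟩)

/-- If no boundary point of the bounded open set `X` is interior to `hat X`, then `X` and the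
unbounded component of the complement of `hat X` have the same boundary. -/
lemma frontier_eq_frontier_of_disjoint_interior_hat {X : Set ℂ} (hX : IsOpen X)
    (hb : IsBounded X) (hdisj : ∀ p ∈ frontier X, p ∉ interior (hat X)) {z : ℂ} (hz : z ∉ hat X)
    (hunb : ¬ IsBounded (connectedComponentIn (hat X)ᶜ z)) :
    frontier X = frontier (connectedComponentIn (hat X)ᶜ z) := by
  rw [connectedComponentIn_compl_hat hz] at hunb ⊢
  have hWX := connectedComponentIn_subset (closure X)ᶜ z
  have hWo : IsOpen (connectedComponentIn (closure X)ᶜ z) :=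
    isClosed_closure.isOpen_compl.connectedComponentIn
  have hcover : (hat X)ᶜ ⊆ connectedComponentIn (closure X)ᶜ z := by
    intro w hw
    have hwX : w ∉ closure X := fun h => hw (Or.inl h)
    rw [connectedComponentIn_compl_eq_of_not_isBounded hb.closure hunb
      fun h => hw (Or.inr ⟨hwX, h⟩)]
    exact mem_connectedComponentIn hwX
  apply Subset.antisymm
  · intro y hy
    rw [hWo.frontier_eq]
    refine ⟨?_, fun hyW => hWX hyW (frontier_subset_closure hy)⟩
    by_contra hyW
    refine hdisj y hy (mem_interior.2 ⟨_, fun w hw => ?_, isClosed_closure.isOpen_compl, hyW⟩)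
    by_contra hwK
    exact hw (subset_closure (hcover hwK))
  · intro y hy
    have hyX : y ∈ closure X := by
      by_contra h
      exact notMem_frontier_connectedComponentIn isClosed_closure.isOpen_compl h hy
    rw [hX.frontier_eq]
    refine ⟨hyX, fun hyX' => ?_⟩
    obtain ⟨w, hw, hwW⟩ := mem_closure_iff.1 (frontier_subset_closure hy) X hX hyX'
    exact hWX hwW (subset_closure hw)

/-- The Cesàro mean of `s` twisted by the character `n ↦ ρ ^ (-k n)`. -/
def twistedAverage (ρ : ℂ) (k N : ℕ) (s : ℕ → ℂ) : ℂ :=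
  (N : ℂ)⁻¹ * ∑ n ∈ Finset.range N, ((ρ ^ k)⁻¹) ^ n * s n

lemma norm_twistedAverage_le {ρ : ℂ} (hρ : ‖ρ‖ = 1) {k N : ℕ} {s : ℕ → ℂ} {M : ℝ} (hM : 0 ≤ M)
    (hs : ∀ n, ‖s n‖ ≤ M) : ‖twistedAverage ρ k N s‖ ≤ M := by
  have hsum : ‖∑ n ∈ Finset.range N, ((ρ ^ k)⁻¹) ^ n * s n‖ ≤ N * M := by
    simpa using norm_sum_le_of_le (Finset.range N) (f := fun n => ((ρ ^ k)⁻¹) ^ n * s n)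
      (n := fun _ => M) fun n _ => by simpa [hρ] using hs n
  rw [twistedAverage, norm_mul, norm_inv, Complex.norm_natCast]
  rcases N.eq_zero_or_pos with rfl | hN
  · simpa using hM
  · have hN' : (0 : ℝ) < N := mod_cast hN
    rw [inv_mul_le_iff₀ hN']
    exact hsum

lemma twistedAverage_sub (ρ : ℂ) (k N : ℕ) (s t : ℕ → ℂ) :
    twistedAverage ρ k N s - twistedAverage ρ k N t =
      twistedAverage ρ k N (fun n => s n - t n) := by
  simp only [twistedAverage, mul_sub, Finset.sum_sub_distrib]

lemma twistedAverage_const_mul (ρ : ℂ) (k N : ℕ) (c : ℂ) (s : ℕ → ℂ) :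
    twistedAverage ρ k N (fun n => c * s n) = c * twistedAverage ρ k N s := by
  simp only [twistedAverage, Finset.mul_sum]
  exact Finset.sum_congr rfl fun n _ => by ring

lemma differentiable_twistedAverage_iterate {f : ℂ → ℂ} (hf : Differentiable ℂ f) (ρ : ℂ)
    (k N : ℕ) : Differentiable ℂ fun z => twistedAverage ρ k N fun n => f^[n] z := by
  unfold twistedAverage
  exact (Differentiable.fun_sum fun n _ => (hf.iterate n).const_mul _).const_mul _

/-- Orthogonality of the characters of an infinite cyclic rotation. -/
lemma tendsto_twistedAverage_pow {ρ : ℂ} (hρ : ‖ρ‖ = 1) (hinj : Function.Injective (ρ ^ · : ℕ → ℂ))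
    (k j : ℕ) : Tendsto (fun N => twistedAverage ρ k N fun n => (ρ ^ n) ^ j) atTop
      (𝓝 (if j = k then 1 else 0)) := by
  have hρ0 : ρ ≠ 0 := norm_ne_zero_iff.1 (by simp [hρ])
  have hterm : ∀ n, ((ρ ^ k)⁻¹) ^ n * (ρ ^ n) ^ j = (ρ ^ j / ρ ^ k) ^ n := fun n => by
    rw [div_eq_inv_mul, mul_pow, ← pow_mul ρ n, mul_comm n j, pow_mul ρ j]
  simp only [twistedAverage, hterm]
  split_ifs with h
  · subst h
    refine tendsto_const_nhds.congr' ?_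
    filter_upwards [eventually_gt_atTop 0] with N hN
    have : (N : ℂ) ≠ 0 := mod_cast hN.ne'
    simp [hρ0, this]
  · have hx : ρ ^ j / ρ ^ k ≠ 1 := fun hx =>
      h (hinj ((div_eq_one_iff_eq (pow_ne_zero k hρ0)).1 hx))
    have hlim : Tendsto (fun N : ℕ => (N : ℝ)⁻¹ * (2 / ‖ρ ^ j / ρ ^ k - 1‖)) atTop (𝓝 0) := by
      simpa using tendsto_inv_atTop_nhds_zero_nat.mul_const (2 / ‖ρ ^ j / ρ ^ k - 1‖)
    refine squeeze_zero_norm (fun N => ?_) hlim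
    rw [geom_sum_eq hx, norm_mul, norm_inv, Complex.norm_natCast, norm_div]
    gcongr
    refine (norm_sub_le _ _).trans_eq ?_
    simp [hρ]
    norm_num

/-- Twisted averages of a holomorphic function along rotations isolate one Taylor term, uniformly
on smaller disks. -/
lemma eventually_norm_twistedAverage_comp_sub_le {φ : ℂ → ℂ}
    (hφ : DifferentiableOn ℂ φ (ball 0 1)) {ρ : ℂ} (hρ : ‖ρ‖ = 1)
    (hinj : Function.Injective (ρ ^ · : ℕ → ℂ)) (k : ℕ) {t : ℝ} (ht0 : 0 ≤ t) (ht : t < 1)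
    {ε : ℝ} (hε : 0 < ε) :
    ∀ᶠ N in atTop, ∀ u : ℂ, ‖u‖ ≤ t →
      ‖twistedAverage ρ k N (fun n => φ (ρ ^ n * u)) -
        (k.factorial : ℂ)⁻¹ * iteratedDeriv k φ 0 * u ^ k‖ ≤ ε := by
  set a : ℕ → ℂ := fun j => (j.factorial : ℂ)⁻¹ * iteratedDeriv j φ 0 with ha
  have htaylor : ∀ u : ℂ, ‖u‖ < 1 → HasSum (fun j => a j * u ^ j) (φ u) := by
    intro u hu
    convert! Complex.hasSum_taylorSeries_on_ball hφ (mem_ball_zero_iff.2 hu) using 2 with j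
    simp [ha]
    ring
  set A : ℕ → ℕ → ℂ := fun N j =>
    (twistedAverage ρ k N fun n => (ρ ^ n) ^ j) - if j = k then 1 else 0 with hA
  have hA0 : ∀ j, Tendsto (fun N => A N j) atTop (𝓝 0) := fun j => by
    simpa using (tendsto_twistedAverage_pow hρ hinj k j).sub_const (if j = k then 1 else 0)
  have hA2 : ∀ N j, ‖A N j‖ ≤ 2 := fun N j => by
    refine (norm_sub_le _ _).trans ?_
    have h1 : ‖twistedAverage ρ k N fun n => (ρ ^ n) ^ j‖ ≤ 1 :=
      norm_twistedAverage_le hρ zero_le_one fun n => by simp [hρ]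
    have h2 : ‖(if j = k then 1 else 0 : ℂ)‖ ≤ 1 := by split_ifs <;> simp
    linarith
  have hsum : Summable fun j => ‖a j‖ * t ^ j := by
    have := (htaylor t (by simpa [abs_of_nonneg ht0] using ht)).summable.norm
    simpa [abs_of_nonneg ht0] using this
  have hbound : ∀ N j, ‖‖a j‖ * t ^ j * ‖A N j‖‖ ≤ ‖a j‖ * t ^ j * 2 := fun N j => by
    rw [Real.norm_of_nonneg (by positivity)]
    gcongr
    exact hA2 N j
  have hlim : Tendsto (fun N => ∑' j, ‖a j‖ * t ^ j * ‖A N j‖) atTop (𝓝 0) := by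
    simpa using tendsto_tsum_of_dominated_convergence (g := fun _ => (0 : ℝ)) (hsum.mul_right 2)
      (fun j => by simpa using (hA0 j).norm.const_mul (‖a j‖ * t ^ j))
      (Eventually.of_forall hbound)
  filter_upwards [hlim.eventually_le_const hε] with N hN u hu
  have hu1 := hu.trans_lt ht
  have hleft : HasSum (fun j => a j * u ^ j * twistedAverage ρ k N fun n => (ρ ^ n) ^ j)
      (twistedAverage ρ k N fun n => φ (ρ ^ n * u)) := by
    have h : ∀ n ∈ Finset.range N, HasSum (fun j => ((ρ ^ k)⁻¹) ^ n * (a j * (ρ ^ n * u) ^ j))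
        (((ρ ^ k)⁻¹) ^ n * φ (ρ ^ n * u)) := fun n _ =>
      (htaylor _ (by simpa [hρ] using hu1)).mul_left _
    convert! (hasSum_sum h).mul_left (N : ℂ)⁻¹ using 2 with j
    rw [← twistedAverage_const_mul, twistedAverage]
    congr 1
    exact Finset.sum_congr rfl fun n _ => by ring
  have hright : HasSum (fun j => a j * u ^ j * if j = k then 1 else 0) (a k * u ^ k) := by
    convert! hasSum_ite_eq k (a k * u ^ k) using 2 with j
    split_ifs with h <;> simp [h]
  have hdiff := hleft.sub hright
  rw [← hdiff.tsum_eq]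
  refine (tsum_of_norm_bounded (Summable.of_norm_bounded (hsum.mul_right 2) (hbound N)).hasSum
    fun j => ?_).trans hN
  rw [← mul_sub, norm_mul, norm_mul, norm_pow]
  gcongr

/-- Powers of an irrational rotation number are dense in the circle. -/
lemma mem_closure_range_exp_pow {θ : ℝ} (hθ : Irrational θ) {v : ℂ} (hv : ‖v‖ = 1) :
    v ∈ closure (range fun n : ℕ => Complex.exp (2 * Real.pi * θ * Complex.I) ^ n) := by
  have hdense : DenseRange fun n : ℕ => n • (θ : AddCircle (1 : ℝ)) :=
    denseRange_zsmul_iff_nsmul.1 (AddCircle.denseRange_zsmul_coe_iff.2 (by simpa using hθ))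
  have hcont : Continuous fun x : AddCircle (1 : ℝ) => (x.toCircle : ℂ) :=
    continuous_subtype_val.comp AddCircle.continuous_toCircle
  obtain ⟨x, hx⟩ : ∃ x : AddCircle (1 : ℝ), (x.toCircle : ℂ) = v := by
    refine ⟨((Complex.arg v / (2 * Real.pi) : ℝ) : AddCircle (1 : ℝ)), ?_⟩
    have h : 2 * Real.pi / 1 * (Complex.arg v / (2 * Real.pi)) = Complex.arg v := by field_simp
    rw [AddCircle.toCircle_apply_mk, h, Circle.coe_exp]
    simpa [hv] using Complex.norm_mul_exp_arg_mul_I v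
  rw [← hx]
  refine hcont.continuousAt.continuousWithinAt.mem_closure (hdense x) ?_
  rintro _ ⟨n, rfl⟩
  refine ⟨n, ?_⟩
  simp only [AddCircle.toCircle_nsmul, AddCircle.toCircle_apply_mk, Circle.coe_pow, Circle.coe_exp]
  congr 2
  push_cast
  ring

lemma injective_exp_pow {θ : ℝ} (hθ : Irrational θ) :
    Function.Injective (Complex.exp (2 * Real.pi * θ * Complex.I) ^ · : ℕ → ℂ) := by
  intro m n h
  simp only [← Complex.exp_nat_mul] at h
  obtain ⟨l, hl⟩ := Complex.exp_eq_exp_iff_exists_int.1 h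
  have hl' : (2 * Real.pi * Complex.I : ℂ) * (((m : ℝ) * θ : ℝ) : ℂ) =
      2 * Real.pi * Complex.I * (((n : ℝ) * θ + l : ℝ) : ℂ) := by
    push_cast
    linear_combination hl
  have hreal : (m : ℝ) * θ = n * θ + l :=
    Complex.ofReal_injective (mul_left_cancel₀ Complex.two_pi_I_ne_zero hl')
  by_contra hne
  have hmn : ((m : ℤ) - n : ℤ) ≠ 0 := sub_ne_zero.2 (mod_cast hne)
  refine (hθ.intCast_mul hmn).ne_int l ?_
  push_cast
  linear_combination hreal

/-- If two points of the unit disk have `φ`-images that stay close along an irrational rotation,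
then the images stay close along all dilations by factors in the disk. -/
lemma norm_sub_le_of_forall_rotation {φ : ℂ → ℂ} (hφ : DifferentiableOn ℂ φ (ball 0 1)) {θ : ℝ}
    (hθ : Irrational θ) {w₁ w₂ : ℂ} (h₁ : ‖w₁‖ < 1) (h₂ : ‖w₂‖ < 1) {C : ℝ}
    (hC : ∀ n : ℕ, ‖φ (Complex.exp (2 * Real.pi * θ * Complex.I) ^ n * w₁) -
      φ (Complex.exp (2 * Real.pi * θ * Complex.I) ^ n * w₂)‖ ≤ C) {u : ℂ} (hu : ‖u‖ ≤ 1) :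
    ‖φ (u * w₁) - φ (u * w₂)‖ ≤ C := by
  have hmem : ∀ {w v : ℂ}, ‖w‖ < 1 → ‖v‖ ≤ 1 → v * w ∈ ball (0 : ℂ) 1 := fun hw hv => by
    rw [mem_ball_zero_iff, norm_mul]
    exact (mul_le_of_le_one_left (norm_nonneg _) hv).trans_lt hw
  have hdiff : ∀ v ∈ closedBall (0 : ℂ) 1,
      DifferentiableAt ℂ (fun v => φ (v * w₁) - φ (v * w₂)) v := by
    intro v hv
    have hv' := mem_closedBall_zero_iff.1 hv
    have hcomp : ∀ {w : ℂ}, ‖w‖ < 1 → DifferentiableAt ℂ (fun v => φ (v * w)) v := fun {w} hw =>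
      DifferentiableAt.comp (f := fun v => v * w) v
        (hφ.differentiableAt (isOpen_ball.mem_nhds (hmem hw hv')))
        (differentiableAt_id.mul_const _)
    exact (hcomp h₁).sub (hcomp h₂)
  refine Complex.norm_le_of_forall_mem_frontier_norm_le (U := ball 0 1) isBounded_ball
    (f := fun v => φ (v * w₁) - φ (v * w₂)) ?_ ?_ ?_
  · refine DifferentiableOn.diffContOnCl fun v hv => (hdiff v ?_).differentiableWithinAt
    exact closure_ball_subset_closedBall hv
  · intro v hv
    rw [frontier_ball _ one_ne_zero, mem_sphere_zero_iff_norm] at hv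
    have hv' : v ∈ closedBall (0 : ℂ) 1 := by simp [hv]
    have := (hdiff v hv').continuousAt.norm.continuousWithinAt.mem_closure
      (mem_closure_range_exp_pow hθ hv) (t := Iic C) (by rintro _ ⟨n, rfl⟩; exact hC n)
    simpa [isClosed_Iic.closure_eq] using this
  · rw [closure_ball _ one_ne_zero]
    simpa using hu

/-- If `φ` is a uniform limit of its own dilations by factors `τ j → 1` in the disk, then twisted
averages of `φ` along rotations isolate one Taylor term uniformly on the whole disk. -/
lemma eventually_norm_twistedAverage_comp_sub_le_of_dilation {φ : ℂ → ℂ}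
    (hφ : DifferentiableOn ℂ φ (ball 0 1)) {ρ : ℂ} (hρ : ‖ρ‖ = 1)
    (hinj : Function.Injective (ρ ^ · : ℕ → ℂ)) {τ : ℕ → ℂ} (hτ : ∀ j, ‖τ j‖ < 1)
    (hτ1 : Tendsto τ atTop (𝓝 1))
    (happrox : ∀ ε > 0, ∀ᶠ j in atTop, ∀ w ∈ ball (0 : ℂ) 1, ‖φ (w * τ j) - φ w‖ ≤ ε)
    (k : ℕ) {ε : ℝ} (hε : 0 < ε) :
    ∀ᶠ N in atTop, ∀ w ∈ ball (0 : ℂ) 1, ‖twistedAverage ρ k N (fun n => φ (ρ ^ n * w)) -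
      (k.factorial : ℂ)⁻¹ * iteratedDeriv k φ 0 * w ^ k‖ ≤ ε := by
  set a := (k.factorial : ℂ)⁻¹ * iteratedDeriv k φ 0
  have hcoeff : Tendsto (fun j => ‖a * (τ j ^ k - 1)‖) atTop (𝓝 0) := by
    simpa using (((hτ1.pow k).sub_const 1).const_mul a).norm
  obtain ⟨j, hj, hjk⟩ := ((happrox (ε / 3) (by positivity)).and
    (hcoeff.eventually_le_const (by positivity : 0 < ε / 3))).exists
  filter_upwards [eventually_norm_twistedAverage_comp_sub_le hφ hρ hinj k (norm_nonneg (τ j))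
    (hτ j) (by positivity : 0 < ε / 3)] with N hN w hw
  have hw1 := mem_ball_zero_iff.1 hw
  have h1 : ‖twistedAverage ρ k N (fun n => φ (ρ ^ n * w)) -
      twistedAverage ρ k N (fun n => φ (ρ ^ n * (w * τ j)))‖ ≤ ε / 3 := by
    rw [twistedAverage_sub]
    refine norm_twistedAverage_le hρ (by positivity) fun n => ?_
    rw [norm_sub_rev, ← mul_assoc]
    exact hj _ (by simpa [hρ] using hw1)
  have h2 := hN (w * τ j) (by
    rw [norm_mul]
    exact mul_le_of_le_one_left (norm_nonneg _) hw1.le)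
  have h3 : ‖a * (w * τ j) ^ k - a * w ^ k‖ ≤ ε / 3 := by
    have : a * (w * τ j) ^ k - a * w ^ k = a * (τ j ^ k - 1) * w ^ k := by ring
    rw [this, norm_mul, norm_pow]
    exact (mul_le_of_le_one_right (norm_nonneg _) (pow_le_one₀ (norm_nonneg _) hw1.le)).trans hjk
  have h12 := norm_sub_le_norm_sub_add_norm_sub (twistedAverage ρ k N (fun n => φ (ρ ^ n * w)))
    (twistedAverage ρ k N (fun n => φ (ρ ^ n * (w * τ j)))) (a * (w * τ j) ^ k)
  have h123 := norm_sub_le_norm_sub_add_norm_sub (twistedAverage ρ k N (fun n => φ (ρ ^ n * w)))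
    (a * (w * τ j) ^ k) (a * w ^ k)
  linarith

/-- A nonconstant holomorphic function on the unit disk has a nonzero Taylor coefficient of positive
degree at the origin. -/
lemma exists_iteratedDeriv_ne_zero_of_injOn {φ : ℂ → ℂ} (hφ : DifferentiableOn ℂ φ (ball 0 1))
    (hinj : InjOn φ (ball 0 1)) : ∃ k ≠ 0, iteratedDeriv k φ 0 ≠ 0 := by
  by_contra! h
  have hconst : ∀ w ∈ ball (0 : ℂ) 1, φ w = φ 0 := fun w hw => by
    rw [← Complex.taylorSeries_eq_on_ball' hw hφ, tsum_eq_single 0 fun k hk => by simp [h k hk]]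
    simp
  have hhalf : (1 / 2 : ℂ) ∈ ball (0 : ℂ) 1 := by
    rw [mem_ball_zero_iff]
    norm_num
  simpa using hinj hhalf (mem_ball_self one_pos) (hconst _ hhalf)

/-- If entire functions converge uniformly on `φ '' ball 0 1` to the function which reads `a * w ^ k`
in the coordinate `φ`, with `a ≠ 0` and `k ≠ 0`, then a limit of points `φ (w j)` with `‖w j‖ → 1`
is not interior to the hull. -/
lemma notMem_interior_hat_of_uniform_limit {φ : ℂ → ℂ} {h : ℕ → ℂ → ℂ}
    (hh : ∀ N, Differentiable ℂ (h N)) {a : ℂ} (ha : a ≠ 0) {k : ℕ} (hk : k ≠ 0)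
    (hlim : ∀ ε > 0, ∀ᶠ N in atTop, ∀ w ∈ ball (0 : ℂ) 1, ‖h N (φ w) - a * w ^ k‖ ≤ ε)
    {p w₀ : ℂ} {w : ℕ → ℂ} (hw : ∀ j, w j ∈ ball (0 : ℂ) 1) (hw₀ : Tendsto w atTop (𝓝 w₀))
    (hw₀1 : ‖w₀‖ = 1) (hp : Tendsto (fun j => φ (w j)) atTop (𝓝 p)) :
    p ∉ interior (hat (φ '' ball 0 1)) := by
  intro hpint
  set K := hat (φ '' ball 0 1)
  have hcauchy : UniformCauchySeqOn h atTop K := by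
    rw [Metric.uniformCauchySeqOn_iff]
    intro ε hε
    obtain ⟨N₀, hN₀⟩ := eventually_atTop.1 (hlim (ε / 3) (by positivity))
    refine ⟨N₀, fun m hm n hn z hz => ?_⟩
    rw [dist_eq_norm]
    refine (norm_le_of_mem_hat (P := fun z => h m z - h n z) ((hh m).sub (hh n))
      (M := ε / 3 + ε / 3) ?_ hz).trans_lt (by linarith)
    rintro _ ⟨v, hv, rfl⟩
    have := norm_sub_le_norm_sub_add_norm_sub (h m (φ v)) (a * v ^ k) (h n (φ v))
    rw [norm_sub_rev (a * v ^ k)] at this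
    linarith [hN₀ m hm v hv, hN₀ n hn v hv]
  choose! H hH using fun z (hz : z ∈ K) => cauchySeq_tendsto_of_complete (hcauchy.cauchySeq hz)
  have hunif : TendstoUniformlyOn h H atTop K := hcauchy.tendstoUniformlyOn_of_tendsto hH
  have hdiff : DifferentiableOn ℂ H (interior K) :=
    (hunif.mono interior_subset).tendstoLocallyUniformlyOn.differentiableOn
      (Eventually.of_forall fun N => (hh N).differentiableOn) isOpen_interior
  have hcoord : ∀ v ∈ ball (0 : ℂ) 1, H (φ v) = a * v ^ k := fun v hv => by
    refine tendsto_nhds_unique (hH _ (Or.inl (subset_closure (mem_image_of_mem φ hv)))) ?_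
    rw [Metric.tendsto_nhds]
    intro ε hε
    filter_upwards [hlim (ε / 2) (by positivity)] with N hN
    rw [dist_eq_norm]
    linarith [hN v hv]
  have hle : ∀ z ∈ K, ‖H z‖ ≤ ‖a‖ := fun z hz => by
    refine le_of_forall_pos_le_add fun ε hε => le_of_tendsto (hH z hz).norm ?_
    filter_upwards [hlim ε hε] with N hN
    refine norm_le_of_mem_hat (hh N) ?_ hz
    rintro _ ⟨v, hv, rfl⟩
    have h1 : ‖a * v ^ k‖ ≤ ‖a‖ := by
      rw [norm_mul, norm_pow]
      exact mul_le_of_le_one_right (norm_nonneg _)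
        (pow_le_one₀ (norm_nonneg _) (mem_ball_zero_iff.1 hv).le)
    have h2 := norm_le_norm_add_norm_sub' (h N (φ v)) (a * v ^ k)
    linarith [hN v hv]
  have hnhds : interior K ∈ 𝓝 p := isOpen_interior.mem_nhds hpint
  have hHp : H p = a * w₀ ^ k := by
    refine tendsto_nhds_unique (((hdiff.differentiableAt hnhds).continuousAt.tendsto).comp hp) ?_
    exact ((hw₀.pow k).const_mul a).congr fun j => (hcoord _ (hw j)).symm
  have hnorm : ‖H p‖ = ‖a‖ := by simp [hHp, hw₀1]
  have hmax : IsLocalMax (norm ∘ H) p := by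
    filter_upwards [hnhds] with z hz
    simpa [hnorm] using hle z (interior_subset hz)
  have hconst := Complex.eventually_eq_of_isLocalMax_norm
    (by filter_upwards [hnhds] with z hz using hdiff.differentiableAt (isOpen_interior.mem_nhds hz))
    hmax
  obtain ⟨j, hj⟩ := (hp.eventually hconst).exists
  rw [hcoord _ (hw j)] at hj
  have hj' := congrArg norm hj
  rw [hnorm, norm_mul, norm_pow] at hj'
  exact (mul_lt_of_lt_one_right (norm_pos_iff.2 ha)
    (pow_lt_one₀ (norm_nonneg _) (mem_ball_zero_iff.1 (hw j)) hk)).ne hj'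

/-- No boundary point of a bounded Siegel disk is interior to its hull. -/
lemma IsSiegelDisk.notMem_interior_hat {f : ℂ → ℂ} (hf : Differentiable ℂ f) {Δ : Set ℂ} {θ : ℝ}
    (hΔ : IsSiegelDisk f Δ θ) (hb : IsBounded Δ) {p : ℂ} (hp : p ∈ frontier Δ) :
    p ∉ interior (hat Δ) := by
  intro hpint
  obtain ⟨hopen, -, -, -, hθ, φ, ⟨hφ, hφinj, rfl⟩, hconj⟩ := hΔ
  have hρ : ‖Complex.exp (2 * Real.pi * θ * Complex.I)‖ = 1 := by
    simpa using Complex.norm_exp_ofReal_mul_I (2 * Real.pi * θ)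
  have hinj := injective_exp_pow hθ
  have hdense := fun {w₁ w₂ : ℂ} => norm_sub_le_of_forall_rotation hφ hθ (w₁ := w₁) (w₂ := w₂)
  set ρ := Complex.exp (2 * Real.pi * θ * Complex.I)
  have hiter : ∀ n : ℕ, ∀ w ∈ ball (0 : ℂ) 1, f^[n] (φ w) = φ (ρ ^ n * w) := by
    intro n
    induction n with
    | zero => simp
    | succ n ih =>
      intro w hw
      rw [Function.iterate_succ_apply', ih w hw,
        hconj _ (by simpa [hρ] using hw), pow_succ', mul_assoc]
  obtain ⟨M, hM⟩ := isBounded_iff_forall_norm_le.1 hb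
  have hMhat : ∀ n : ℕ, ∀ z ∈ hat (φ '' ball 0 1), ‖f^[n] z‖ ≤ M := by
    refine fun n z hz => norm_le_of_mem_hat (hf.iterate n) ?_ hz
    rintro _ ⟨w, hw, rfl⟩
    rw [hiter n w hw]
    exact hM _ (mem_image_of_mem φ (by simpa [hρ] using hw))
  obtain ⟨r, hr, hrK⟩ := Metric.isOpen_iff.1 isOpen_interior p hpint
  have hlip : ∀ n : ℕ, ∀ q ∈ ball p r, dist (f^[n] q) (f^[n] p) ≤ 2 * M / r * dist q p := by
    refine fun n q hq => Complex.dist_le_div_mul_dist_of_mapsTo_ball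
      (hf.iterate n).differentiableOn (fun z hz => ?_) hq
    rw [mem_closedBall, dist_eq_norm]
    refine (norm_sub_le _ _).trans ?_
    linarith [hMhat n z (interior_subset (hrK hz)), hMhat n p (interior_subset hpint)]
  obtain ⟨q, hqmem, hqp⟩ := mem_closure_iff_seq_limit.1 (frontier_subset_closure hp)
  choose v hv hvq using hqmem
  obtain ⟨w₀, hw₀, s, hs, hw⟩ := (isCompact_closedBall (0 : ℂ) 1).tendsto_subseq
    fun j => ball_subset_closedBall (hv j)
  have hwmem : ∀ j, v (s j) ∈ ball (0 : ℂ) 1 := fun j => hv (s j)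
  have hwp : Tendsto (fun j => φ (v (s j))) atTop (𝓝 p) := by
    simpa only [hvq, Function.comp_def] using hqp.comp hs.tendsto_atTop
  have hw₀1 : ‖w₀‖ = 1 := by
    refine (mem_closedBall_zero_iff.1 hw₀).antisymm (not_lt.1 fun hlt => ?_)
    have hw₀mem : w₀ ∈ ball (0 : ℂ) 1 := mem_ball_zero_iff.2 hlt
    have hcont := (hφ.differentiableAt (isOpen_ball.mem_nhds hw₀mem)).continuousAt
    rw [hopen.frontier_eq] at hp
    exact hp.2 ⟨w₀, hw₀mem, tendsto_nhds_unique (hcont.tendsto.comp hw) hwp⟩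
  have hw₀0 : w₀ ≠ 0 := norm_ne_zero_iff.1 (by simp [hw₀1])
  have happrox : ∀ ε > 0, ∀ᶠ j in atTop, ∀ w ∈ ball (0 : ℂ) 1,
      ‖φ (w * (v (s j) / w₀)) - φ w‖ ≤ ε := by
    intro ε hε
    have hsmall : Tendsto (fun j => 2 * M / r * dist (φ (v (s j))) p) atTop (𝓝 0) := by
      simpa using (tendsto_iff_dist_tendsto_zero.1 hwp).const_mul (2 * M / r)
    have hev := (hwp.eventually (ball_mem_nhds p hr)).and
      (hsmall.eventually_le_const (half_pos hε))
    have hclose : ∀ᶠ j in atTop, ∀ n : ℕ, dist (φ (ρ ^ n * v (s j))) (f^[n] p) ≤ ε / 2 := by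
      filter_upwards [hev] with j hj n
      rw [← hiter n _ (hwmem j)]
      exact (hlip n _ hj.1).trans hj.2
    filter_upwards [hclose] with j hj w hwball
    have hw1 := mem_ball_zero_iff.1 hwball
    have hu : ‖w / w₀‖ < 1 := by simpa [hw₀1] using hw1
    have hlimφ : Tendsto (fun l => φ (w / w₀ * v (s l))) atTop (𝓝 (φ w)) := by
      refine (hφ.differentiableAt (isOpen_ball.mem_nhds hwball)).continuousAt.tendsto.comp ?_
      simpa [div_mul_cancel₀ w hw₀0] using hw.const_mul (w / w₀)
    have hrw : w * (v (s j) / w₀) = w / w₀ * v (s j) := by ring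
    rw [hrw]
    refine le_of_tendsto (tendsto_const_nhds.sub hlimφ).norm ?_
    filter_upwards [hclose] with l hl
    refine hdense (mem_ball_zero_iff.1 (hwmem j)) (mem_ball_zero_iff.1 (hwmem l))
      (fun n => ?_) hu.le
    rw [← dist_eq_norm]
    linarith [dist_triangle_right (φ (ρ ^ n * v (s j))) (φ (ρ ^ n * v (s l))) (f^[n] p), hj n, hl n]
  obtain ⟨k, hk, hak⟩ := exists_iteratedDeriv_ne_zero_of_injOn hφ hφinj
  refine notMem_interior_hat_of_uniform_limit
    (fun N => differentiable_twistedAverage_iterate hf ρ k N)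
    (mul_ne_zero (inv_ne_zero (Nat.cast_ne_zero.2 k.factorial_ne_zero)) hak) hk (fun ε hε => ?_)
    hwmem hw hw₀1 hwp hpint
  have hτ1 : Tendsto (fun j => v (s j) / w₀) atTop (𝓝 1) := by
    simpa [div_self hw₀0] using hw.div_const w₀
  filter_upwards [eventually_norm_twistedAverage_comp_sub_le_of_dilation hφ hρ hinj
    (fun j => by simpa [hw₀1] using hwmem j) hτ1 happrox k hε] with N hN w hwball
  simpa only [hiter _ w hwball] using hN w hwball

/-- `∂Δ = ∂Δ_∞` for the unbounded component `Δ_∞` of `ℂ \ Δ̂`. -/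
theorem stmt7 (f : ℂ → ℂ) (hf : Differentiable ℂ f) (Δ : Set ℂ) (θ : ℝ)
    (hΔ : IsSiegelDisk f Δ θ) (hb : IsBounded Δ) (z : ℂ) (hz : z ∉ hat Δ)
    (hunb : ¬ IsBounded (connectedComponentIn (hat Δ)ᶜ z)) :
    frontier Δ = frontier (connectedComponentIn (hat Δ)ᶜ z) := by
  exact frontier_eq_frontier_of_disjoint_interior_hat hΔ.1 hb
    (fun _ hp => hΔ.notMem_interior_hat hf hb hp) hz hunb
end
end

section
/- Let f be an entire function with no wandering domains satisfying the Separation Property, and let Δ be a bounded forward invariant Siegel disk of f with S(f) ∩ Δ̂ = ∅. Then Δ has no hidden components, i.e., ℂ \ closure(Δ) has no bounded connected components. -/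
open Set Topology Bornology Filter Metric

noncomputable section

/-! ### Coverings of planar lattice regions -/

/-- The six neighbours of the origin in the triangular lattice, in cyclic order. -/
def hexDir (i : ZMod 6) : ℤ × ℤ :=
  ![(1, 0), (0, 1), (-1, 1), (-1, 0), (0, -1), (1, -1)] (i : Fin 6)

/-- Adjacency in the triangular lattice. -/
def LatticeAdj (v w : ℤ × ℤ) : Prop := ∃ i : ZMod 6, w = v + hexDir i

lemma hexDir_add_three (i : ZMod 6) : hexDir (i + 3) = -hexDir i := by
  revert i; decide

lemma hexDir_succ_sub (i : ZMod 6) : hexDir (i + 1) = hexDir i + hexDir (i + 2) := by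
  revert i; decide

lemma LatticeAdj.symm {v w : ℤ × ℤ} (h : LatticeAdj v w) : LatticeAdj w v := by
  obtain ⟨i, rfl⟩ := h
  exact ⟨i + 3, by rw [hexDir_add_three]; abel⟩

lemma latticeAdj_add_hexDir_succ (q : ℤ × ℤ) (i : ZMod 6) :
    LatticeAdj (q + hexDir i) (q + hexDir (i + 1)) :=
  ⟨i + 2, by rw [hexDir_succ_sub]; abel⟩

/-- Whether the edge `ab` crosses the upward ray issued from (the right of) `z`, modulo two. -/
def rayCrossing (z a b : ℤ × ℤ) : ZMod 2 :=
  if (a.1 = z.1 ∧ b.1 = z.1 + 1 ∧ z.2 < a.2) ∨ (b.1 = z.1 ∧ a.1 = z.1 + 1 ∧ z.2 < b.2)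
  then 1 else 0

/-- The primitive of the change of `rayCrossing` between adjacent base points. -/
def rayPrimitive (z z' a : ℤ × ℤ) : ZMod 2 :=
  if z'.1 = z.1 then 0
  else if z'.1 = z.1 + 1 then (if a.1 = z'.1 ∧ z'.2 < a.2 then 1 else 0)
  else (if a.1 = z.1 ∧ z.2 < a.2 then 1 else 0)

lemma LatticeAdj.cases {v w : ℤ × ℤ} (h : LatticeAdj v w) :
    (w.1 = v.1 + 1 ∧ w.2 = v.2) ∨ (w.1 = v.1 ∧ w.2 = v.2 + 1) ∨
    (w.1 = v.1 - 1 ∧ w.2 = v.2 + 1) ∨ (w.1 = v.1 - 1 ∧ w.2 = v.2) ∨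
    (w.1 = v.1 ∧ w.2 = v.2 - 1) ∨ (w.1 = v.1 + 1 ∧ w.2 = v.2 - 1) := by
  obtain ⟨i, rfl⟩ := h
  fin_cases i <;> simp [hexDir] <;> omega

set_option maxHeartbeats 4000000 in
lemma rayCrossing_add_rayCrossing {z z' a b : ℤ × ℤ} (hz : LatticeAdj z z')
    (hab : LatticeAdj a b) (h1 : a ≠ z) (h2 : a ≠ z') (h3 : b ≠ z) (h4 : b ≠ z') :
    rayCrossing z a b + rayCrossing z' a b = rayPrimitive z z' a + rayPrimitive z z' b := by
  have hz := hz.cases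
  have hab := hab.cases
  obtain ⟨z1, z2⟩ := z
  obtain ⟨w1, w2⟩ := z'
  obtain ⟨a1, a2⟩ := a
  obtain ⟨b1, b2⟩ := b
  simp only [ne_eq, Prod.mk.injEq] at *
  simp only [rayCrossing, rayPrimitive]
  rcases hz with h | h | h | h | h | h <;> obtain ⟨rfl, rfl⟩ := h <;>
  rcases hab with h | h | h | h | h | h <;> obtain ⟨rfl, rfl⟩ := h <;>
  split_ifs <;> first | rfl | (exfalso; omega)

lemma rayCrossing_add_left (q z a b : ℤ × ℤ) :
    rayCrossing (q + z) (q + a) (q + b) = rayCrossing z a b := by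
  simp [rayCrossing, add_assoc]

lemma rayPrimitive_add_left (q z z' a : ℤ × ℤ) :
    rayPrimitive (q + z) (q + z') (q + a) = rayPrimitive z z' a := by
  simp [rayPrimitive, add_assoc]

lemma local_crossing (i n m k : ZMod 6) (hm : 0 < m.val) (hmn : m.val < n.val)
    (hk : 0 < k.val) (hkn : n.val + k.val < 6) :
    rayPrimitive (hexDir (i + m)) 0 (hexDir i) + rayPrimitive (hexDir (i + m)) 0 (hexDir (i + n))
    + (rayPrimitive 0 (hexDir (i + n + k)) (hexDir i)
      + rayPrimitive 0 (hexDir (i + n + k)) (hexDir (i + n)))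
    + (rayCrossing (hexDir (i + m)) (hexDir (i + n)) 0 + rayCrossing (hexDir (i + m)) 0 (hexDir i))
    + (rayCrossing (hexDir (i + n + k)) (hexDir (i + n)) 0
      + rayCrossing (hexDir (i + n + k)) 0 (hexDir i)) = 1 := by
  revert i n m k
  decide +kernel

open Relation in
lemma exists_winding (X : Set (ℤ × ℤ)) {a b : ℤ × ℤ} (ha : a ∈ X)
    (h : ReflTransGen (fun v w => LatticeAdj v w ∧ w ∈ X) a b) :
    ∃ W : ℤ × ℤ → ZMod 2, ∀ z z', LatticeAdj z z' → z ∉ X → z' ∉ X →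
      W z + W z' = rayPrimitive z z' a + rayPrimitive z z' b := by
  suffices b ∈ X ∧ ∃ W : ℤ × ℤ → ZMod 2, ∀ z z', LatticeAdj z z' → z ∉ X → z' ∉ X →
      W z + W z' = rayPrimitive z z' a + rayPrimitive z z' b from this.2
  induction h with
  | refl => exact ⟨ha, 0, fun z z' _ _ _ => by simp [CharTwo.add_self_eq_zero]⟩
  | @tail b c _ hbc ih =>
    obtain ⟨hb, W, hW⟩ := ih
    refine ⟨hbc.2, fun z => W z + rayCrossing z b c, fun z z' hz h h' => ?_⟩
    have h1 := hW z z' hz h h'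
    have h2 := rayCrossing_add_rayCrossing hz hbc.1 (ne_of_mem_of_not_mem hb h)
      (ne_of_mem_of_not_mem hb h') (ne_of_mem_of_not_mem hbc.2 h) (ne_of_mem_of_not_mem hbc.2 h')
    have h3 := CharTwo.add_self_eq_zero (rayPrimitive z z' b)
    linear_combination h1 + h2 + h3

lemma latticeAdj_hexDir (q : ℤ × ℤ) (i : ZMod 6) : LatticeAdj q (q + hexDir i) := ⟨i, rfl⟩

open Relation in
/-- Two neighbours of `q` joined inside `Q` off `q` do not separate two other neighbours of `q`
lying in a connected complement. -/
lemma not_separated {Q : Set (ℤ × ℤ)}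
    (hQ : ∀ c d, c ∉ Q → d ∉ Q → ReflTransGen (fun v w => LatticeAdj v w ∧ w ∉ Q) c d)
    {q : ℤ × ℤ} (hq : q ∈ Q) {i n m k : ZMod 6} (hm : 0 < m.val) (hmn : m.val < n.val)
    (hk : 0 < k.val) (hkn : n.val + k.val < 6) (hi : q + hexDir i ∈ Q)
    (hpath : ReflTransGen (fun v w => LatticeAdj v w ∧ w ∈ Q \ {q}) (q + hexDir i)
      (q + hexDir (i + n)))
    (hj : q + hexDir (i + n) ∈ Q)
    (hc : q + hexDir (i + m) ∉ Q) (hd : q + hexDir (i + n + k) ∉ Q) : False := by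
  have hne : ∀ l, q + hexDir l ≠ q := fun l => by
    rw [Ne, add_eq_left]; revert l; decide
  obtain ⟨W, hW⟩ := exists_winding (Q \ {q}) (a := q + hexDir i) ⟨hi, hne i⟩ hpath
  set P : ℤ × ℤ → ZMod 2 := fun z =>
    W z + rayCrossing z (q + hexDir (i + n)) q + rayCrossing z q (q + hexDir i) with hP
  have key : ∀ c d, c ∉ Q → ReflTransGen (fun v w => LatticeAdj v w ∧ w ∉ Q) c d →
      d ∉ Q ∧ P c = P d := by
    intro c d hc h
    induction h with
    | refl => exact ⟨hc, rfl⟩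
    | @tail x y _ hxy ih =>
      obtain ⟨hx, hcx⟩ := ih
      obtain ⟨hadj, hy⟩ := hxy
      refine ⟨hy, hcx.trans ?_⟩
      have h1 := hW x y hadj (fun h => hx h.1) (fun h => hy h.1)
      have h2 := rayCrossing_add_rayCrossing hadj (latticeAdj_hexDir q (i + n)).symm
        (ne_of_mem_of_not_mem hj hx) (ne_of_mem_of_not_mem hj hy)
        (ne_of_mem_of_not_mem hq hx) (ne_of_mem_of_not_mem hq hy)
      have h3 := rayCrossing_add_rayCrossing hadj (latticeAdj_hexDir q i)
        (ne_of_mem_of_not_mem hq hx) (ne_of_mem_of_not_mem hq hy)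
        (ne_of_mem_of_not_mem hi hx) (ne_of_mem_of_not_mem hi hy)
      have e1 := CharTwo.add_self_eq_zero (rayPrimitive x y q)
      have e2 := CharTwo.add_self_eq_zero (rayPrimitive x y (q + hexDir i))
      have e3 := CharTwo.add_self_eq_zero (rayPrimitive x y (q + hexDir (i + n)))
      have e4 := CharTwo.add_self_eq_zero (P y)
      simp only [hP] at e4 ⊢
      linear_combination h1 + h2 + h3 + e1 + e2 + e3 - e4
  have hcd := (key _ _ hc (hQ _ _ hc hd)).2
  have h1 := hW _ q (latticeAdj_hexDir q (i + m)).symm (fun h => hc h.1) (fun h => h.2 rfl)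
  have h2 := hW q _ (latticeAdj_hexDir q (i + n + k)) (fun h => h.2 rfl) (fun h => hd h.1)
  have h3 := local_crossing i n m k hm hmn hk hkn
  have p0 : ∀ a b, rayPrimitive (q + a) q (q + b) = rayPrimitive a 0 b := fun a b => by
    simpa using rayPrimitive_add_left q a 0 b
  have p1 : ∀ a b, rayPrimitive q (q + a) (q + b) = rayPrimitive 0 a b := fun a b => by
    simpa using rayPrimitive_add_left q 0 a b
  have c0 : ∀ a b, rayCrossing (q + a) (q + b) q = rayCrossing a b 0 := fun a b => by
    simpa using rayCrossing_add_left q a b 0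
  have c1 : ∀ a b, rayCrossing (q + a) q (q + b) = rayCrossing a 0 b := fun a b => by
    simpa using rayCrossing_add_left q a 0 b
  simp only [hP, p0, p1, c0, c1] at hcd h1 h2
  have e1 := CharTwo.add_self_eq_zero (W q)
  have e2 := CharTwo.add_self_eq_zero (W (q + hexDir (i + n + k)))
  have e3 := CharTwo.add_self_eq_zero (rayCrossing (hexDir (i + n + k)) (hexDir (i + n)) 0)
  have e4 := CharTwo.add_self_eq_zero (rayCrossing (hexDir (i + n + k)) 0 (hexDir i))
  have : (1 : ZMod 2) = 0 := by
    linear_combination hcd - h1 - h2 - h3 + e1 + e2 + e3 + e4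
  exact absurd this (by decide)

open Relation in
lemma exists_arc {Q : Set (ℤ × ℤ)}
    (hQ : ∀ c d, c ∉ Q → d ∉ Q → ReflTransGen (fun v w => LatticeAdj v w ∧ w ∉ Q) c d)
    {q : ℤ × ℤ} (hq : q ∈ Q) {i j : ZMod 6} (hi : q + hexDir i ∈ Q) (hj : q + hexDir j ∈ Q)
    (hpath : ReflTransGen (fun v w => LatticeAdj v w ∧ w ∈ Q \ {q}) (q + hexDir i)
      (q + hexDir j)) :
    (∃ n : ℕ, j = i + n ∧ ∀ m ≤ n, q + hexDir (i + m) ∈ Q) ∨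
    (∃ n : ℕ, i = j + n ∧ ∀ m ≤ n, q + hexDir (j + m) ∈ Q) := by
  by_contra! hcon
  obtain ⟨h1, h2⟩ := hcon
  have hlt := ZMod.val_lt (j - i)
  obtain ⟨m, hm, hmQ⟩ := h1 (j - i).val (by simp)
  obtain ⟨k, hk, hkQ⟩ := h2 (i - j).val (by simp)
  have hm0 : m ≠ 0 := by rintro rfl; simp [hi] at hmQ
  have hk0 : k ≠ 0 := by rintro rfl; simp [hj] at hkQ
  have hm1 : m ≠ (j - i).val := by rintro rfl; simp [hj] at hmQ
  have hk1 : k ≠ (i - j).val := by rintro rfl; simp [hi] at hkQ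
  have hlt' := ZMod.val_lt (i - j)
  have hsum : (j - i).val + (i - j).val ≤ 6 := by
    clear * -; revert i j; decide
  have hmv : (m : ZMod 6).val = m := ZMod.val_natCast_of_lt (by omega)
  have hkv : (k : ZMod 6).val = k := ZMod.val_natCast_of_lt (by omega)
  refine not_separated hQ hq (i := i) (n := j - i) (m := m) (k := k) (by omega) (by omega)
    (by omega) (by omega) hi (by simpa using hpath) (by simpa using hj) hmQ (by simpa using hkQ)

lemma not_latticeAdj_self (q : ℤ × ℤ) : ¬ LatticeAdj q q := by
  rintro ⟨i, hi⟩
  rw [eq_comm, add_eq_left] at hi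
  revert i; decide

open Relation in
lemma reach_symm {E : Type*} {T : E → E → Prop} {p : E → Prop}
    (hsymm : ∀ a b, T a b → T b a) {a b : E} (ha : p a)
    (h : ReflTransGen (fun a b => T a b ∧ p b) a b) :
    p b ∧ ReflTransGen (fun a b => T a b ∧ p b) b a := by
  induction h with
  | refl => exact ⟨ha, .refl⟩
  | tail _ hbc ih => exact ⟨hbc.2, .head ⟨hsymm _ _ hbc.1, ih.1⟩ ih.2⟩

/-- A finite nonempty set of lattice points has a point adjacent to its complement. -/
lemma exists_adj_compl {Q : Set (ℤ × ℤ)} (hfin : Q.Finite) {x : ℤ × ℤ} (hx : x ∈ Q) :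
    ∃ q ∈ Q, ∃ c ∉ Q, LatticeAdj q c := by
  by_contra! hcon
  have hall : ∀ n : ℕ, (x.1 + n, x.2) ∈ Q := by
    intro n
    induction n with
    | zero => simpa using hx
    | succ n ih =>
      by_contra hn
      exact hcon _ ih _ hn ⟨0, by simp [hexDir, add_assoc]⟩
  refine Set.infinite_of_injective_forall_mem (fun a b hab => ?_) hall hfin
  simpa using hab

open Relation in
/-- The lifts to `E` of the neighbours of `q` along an arc of the hexagon around `q` are
connected off `q`. -/
lemma reach_of_arc {E : Type*} {π : E → ℤ × ℤ} {T : E → E → Prop} {Q₀ Q : Set (ℤ × ℤ)}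
    (hsymm : ∀ a b, T a b → T b a)
    (hlift : ∀ y w, w ∈ Q₀ → LatticeAdj (π y) w → ∃ y', π y' = w ∧ T y y')
    (huniq : ∀ y a b, T y a → T y b → π a = π b → a = b)
    (hflat : ∀ a b c, T a b → T b c → LatticeAdj (π a) (π c) → T a c)
    (hQ : Q ⊆ Q₀) {y : E} {i : ZMod 6} (n : ℕ) {a b : E} (ha : T y a) (hb : T y b)
    (hai : π a = π y + hexDir i) (hbi : π b = π y + hexDir (i + n))
    (harc : ∀ m ≤ n, π y + hexDir (i + m) ∈ Q) :
    ReflTransGen (fun a b => T a b ∧ π b ∈ Q \ {π y}) a b := by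
  induction n generalizing b with
  | zero =>
    rw [huniq y a b ha hb (by simp [hai, hbi])]
  | succ n ih =>
    obtain ⟨c, hc, hyc⟩ := hlift y (π y + hexDir (i + n)) (hQ (harc n (by omega)))
      (latticeAdj_hexDir _ _)
    refine (ih hyc hc fun m hm => harc m (by omega)).tail
      ⟨hflat c y b (hsymm _ _ hyc) hb ?_, hbi ▸ harc _ le_rfl, fun h => ?_⟩
    · rw [hc, hbi]
      simpa [add_assoc] using latticeAdj_add_hexDir_succ (π y) (i + n)
    · have := latticeAdj_hexDir (π y) (i + (n + 1 : ℕ))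
      rw [← hbi, h] at this
      exact not_latticeAdj_self _ this

open Relation in
/-- A system of lifts over a finite lattice region with connected complement, flat along
triangles, has no monodromy. -/
theorem lattice_monodromy {E : Type*} {π : E → ℤ × ℤ} {T : E → E → Prop} {Q₀ : Set (ℤ × ℤ)}
    (hsymm : ∀ a b, T a b → T b a) (hadj : ∀ a b, T a b → LatticeAdj (π a) (π b))
    (hlift : ∀ y w, w ∈ Q₀ → LatticeAdj (π y) w → ∃ y', π y' = w ∧ T y y')
    (huniq : ∀ y a b, T y a → T y b → π a = π b → a = b)
    (hflat : ∀ a b c, T a b → T b c → LatticeAdj (π a) (π c) → T a c)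
    (n : ℕ) {Q : Set (ℤ × ℤ)} (hn : Q.ncard = n) (hfin : Q.Finite) (hQ₀ : Q ⊆ Q₀)
    (hQ : ∀ c d, c ∉ Q → d ∉ Q → ReflTransGen (fun v w => LatticeAdj v w ∧ w ∉ Q) c d)
    {s s' : E} (hs : π s ∈ Q) (h : ReflTransGen (fun a b => T a b ∧ π b ∈ Q) s s')
    (hss : π s = π s') : s = s' := by
  induction n using Nat.strong_induction_on generalizing Q s s' with
  | _ n IH =>
  obtain ⟨q, hq, c, hc, hqc⟩ := exists_adj_compl hfin hs
  set Q' := Q \ {q} with hQ'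
  have hsub : Q' ⊆ Q := sdiff_subset
  have hIH : ∀ {a b : E}, π a ∈ Q' → ReflTransGen (fun a b => T a b ∧ π b ∈ Q') a b →
      π a = π b → a = b := by
    intro a b ha hab he
    refine IH Q'.ncard (hn ▸ ncard_sdiff_singleton_lt_of_mem hq hfin) rfl (hfin.subset hsub)
      (hsub.trans hQ₀) ?_ ha hab he
    have hmono : ∀ {x z}, ReflTransGen (fun v w => LatticeAdj v w ∧ w ∉ Q) x z →
        ReflTransGen (fun v w => LatticeAdj v w ∧ w ∉ Q') x z := fun h =>
      h.lift id fun _ _ h => ⟨h.1, fun h' => h.2 (hsub h')⟩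
    have hto : ∀ x, x ∉ Q' → ReflTransGen (fun v w => LatticeAdj v w ∧ w ∉ Q') x c := by
      intro x hx
      by_cases hxQ : x ∈ Q
      · obtain rfl : x = q := by by_contra hne; exact hx ⟨hxQ, hne⟩
        exact .single ⟨hqc, fun h => hc (hsub h)⟩
      · exact hmono (hQ x c hxQ hc)
    intro x z hx hz
    exact (hto x hx).trans (reach_symm (T := LatticeAdj) (p := fun w => w ∉ Q')
      (fun _ _ h => LatticeAdj.symm h)
      hz (hto z hz)).2
  have hproj : ∀ {a b}, ReflTransGen (fun a b => T a b ∧ π b ∈ Q') a b →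
      ReflTransGen (fun v w => LatticeAdj v w ∧ w ∈ Q') (π a) (π b) := fun h =>
    h.lift π fun a b h => ⟨hadj _ _ h.1, h.2⟩
  have harc : ∀ {y a b}, π y = q → T y a → T y b → π a ∈ Q' → π b ∈ Q' →
      ReflTransGen (fun v w => LatticeAdj v w ∧ w ∈ Q') (π a) (π b) →
      ReflTransGen (fun a b => T a b ∧ π b ∈ Q') a b := by
    rintro y a b rfl ha hb haQ hbQ hab
    obtain ⟨i, hi⟩ := hadj _ _ ha
    obtain ⟨j, hj⟩ := hadj _ _ hb
    rw [hi, hj] at hab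
    rcases exists_arc hQ hq (hi ▸ hsub haQ) (hj ▸ hsub hbQ) hab with
      ⟨m, rfl, hm⟩ | ⟨m, rfl, hm⟩
    · exact reach_of_arc hsymm hlift huniq hflat hQ₀ m ha hb hi hj hm
    · exact (reach_symm hsymm (p := fun b => π b ∈ Q') hbQ
        (reach_of_arc hsymm hlift huniq hflat hQ₀ m hb ha hj hi hm)).2
  have hback : ∀ {y a z}, π y = q → T y a → π a ∈ Q' →
      ReflTransGen (fun a b => T a b ∧ π b ∈ Q') a z → LatticeAdj (π z) q → T y z := by
    intro y a z hy hya haQ haz hzq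
    obtain ⟨hzQ, hza⟩ := reach_symm hsymm (p := fun b => π b ∈ Q') haQ haz
    obtain ⟨b, hb, hyb⟩ := hlift y (π z) (hQ₀ (hsub hzQ)) (hy ▸ hzq.symm)
    have hab := harc hy hya hyb haQ (hb ▸ hzQ) (hb ▸ hproj haz)
    rwa [hIH hzQ (hza.trans hab) hb.symm]
  have hclosed : ∀ {y z}, π y = q → ReflTransGen (fun a b => T a b ∧ π b ∈ Q) y z →
      z = y ∨ ∃ a, T y a ∧ π a ∈ Q' ∧ ReflTransGen (fun a b => T a b ∧ π b ∈ Q') a z := by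
    intro y z hy hyz
    induction hyz with
    | refl => exact .inl rfl
    | @tail z z' _ hzz ih =>
      rcases ih with rfl | ⟨a, hya, haQ, haz⟩
      · refine .inr ⟨z', hzz.1, ⟨hzz.2, fun h => ?_⟩, .refl⟩
        have := hadj _ _ hzz.1
        rw [hy, h] at this
        exact not_latticeAdj_self _ this
      · by_cases hz' : π z' = q
        · left
          have hT := hback hy hya haQ haz (hz' ▸ hadj _ _ hzz.1)
          exact huniq z z' y hzz.1 (hsymm _ _ hT) (hz'.trans hy.symm)
        · exact .inr ⟨a, hya, haQ, haz.tail ⟨hzz.1, hzz.2, hz'⟩⟩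
  by_cases hcase : ∃ y, π y = q ∧ ReflTransGen (fun a b => T a b ∧ π b ∈ Q) s y
  · obtain ⟨y, hy, hsy⟩ := hcase
    have hys := (reach_symm hsymm (p := fun b => π b ∈ Q) hs hsy).2
    have hmem : ∀ {a z}, π a ∈ Q' → ReflTransGen (fun a b => T a b ∧ π b ∈ Q') a z → π z ≠ q :=
      fun ha h => (reach_symm hsymm (p := fun b => π b ∈ Q') ha h).1.2
    rcases hclosed hy hys with rfl | ⟨a, hya, haQ, haz⟩ <;>
    rcases hclosed hy (hys.trans h) with rfl | ⟨b, hyb, hbQ, hbz⟩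
    · rfl
    · exact absurd (hss.symm.trans hy) (hmem hbQ hbz)
    · exact absurd (hss.trans hy) (hmem haQ haz)
    · obtain ⟨hsQ, hsa⟩ := reach_symm hsymm (p := fun b => π b ∈ Q') haQ haz
      have hsb := (reach_symm hsymm (p := fun b => π b ∈ Q') hbQ hbz).2
      have hab := harc hy hya hyb haQ hbQ ((hproj haz).trans (hss ▸ hproj hsb))
      exact hIH hsQ ((hsa.trans hab).trans hbz) hss
  · have hne : ∀ y, ReflTransGen (fun a b => T a b ∧ π b ∈ Q) s y → π y ≠ q :=
      fun y hsy hy => hcase ⟨y, hy, hsy⟩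
    refine hIH ⟨hs, hne s .refl⟩ ?_ hss
    clear hss
    induction h with
    | refl => exact .refl
    | tail hab hbc ih => exact ih.tail ⟨hbc.1, hbc.2, hne _ (hab.tail hbc)⟩

/-! ### Univalent coverings -/

/-- `f` is univalent on the connected subsets of `f ⁻¹' B`, and maps suitable ones onto `B`. -/
def UnivalentlyCovers (f : ℂ → ℂ) (B : Set ℂ) : Prop :=
  (∀ C, IsPreconnected C → C ⊆ f ⁻¹' B → InjOn f C) ∧
  ∀ x ∈ f ⁻¹' B, ∃ C, IsPreconnected C ∧ x ∈ C ∧ C ⊆ f ⁻¹' B ∧ f '' C ⊇ B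

/-- `y` and `y'` are joined by a connected set with image of diameter less than `r`. -/
def Linked (f : ℂ → ℂ) (r : ℝ) (y y' : ℂ) : Prop :=
  ∃ C, IsPreconnected C ∧ y ∈ C ∧ y' ∈ C ∧ ∀ u ∈ C, ∀ v ∈ C, dist (f u) (f v) < r

section Linked

variable {f : ℂ → ℂ} {r s : ℝ} {x y z : ℂ}

lemma Linked.symm (h : Linked f r x y) : Linked f r y x := by
  obtain ⟨C, hC, hx, hy, h⟩ := h
  exact ⟨C, hC, hy, hx, h⟩

lemma Linked.trans (h : Linked f r x y) (h' : Linked f s y z) : Linked f (r + s) x z := by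
  obtain ⟨C, hC, hx, hy, h⟩ := h
  obtain ⟨D, hD, hy', hz, h'⟩ := h'
  have hr : 0 < r := dist_nonneg.trans_lt (h x hx x hx)
  have hs : 0 < s := dist_nonneg.trans_lt (h' z hz z hz)
  refine ⟨C ∪ D, hC.union y hy hy' hD, .inl hx, .inr hz, ?_⟩
  rintro u (hu | hu) v (hv | hv)
  · linarith [h u hu v hv]
  · linarith [h u hu y hy, h' y hy' v hv, dist_triangle (f u) (f y) (f v)]
  · linarith [h y hy v hv, h' u hu y hy', dist_triangle (f u) (f y) (f v)]
  · linarith [h' u hu v hv]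

lemma Linked.mono (h : Linked f r x y) (hrs : r ≤ s) : Linked f s x y := by
  obtain ⟨C, hC, hx, hy, h⟩ := h
  exact ⟨C, hC, hx, hy, fun u hu v hv => (h u hu v hv).trans_le hrs⟩

lemma Linked.eq (h : Linked f r x y) (hxy : f x = f y)
    (hg : UnivalentlyCovers f (ball (f x) r)) : x = y := by
  obtain ⟨C, hC, hx, hy, h⟩ := h
  exact hg.1 C hC (fun u hu => h u hu x hx) hx hy hxy

lemma UnivalentlyCovers.exists_linked {a w : ℂ} (hg : UnivalentlyCovers f (ball a r))
    (hx : f x ∈ ball a r) (hw : w ∈ ball a r) : ∃ y, f y = w ∧ Linked f (2 * r) x y := by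
  obtain ⟨C, hC, hxC, hsub, hsurj⟩ := hg.2 x hx
  obtain ⟨y, hy, rfl⟩ := hsurj hw
  refine ⟨y, rfl, C, hC, hxC, hy, fun u hu v hv => ?_⟩
  have h1 := mem_ball.1 (hsub hu)
  have h2 := mem_ball'.1 (hsub hv)
  linarith [dist_triangle (f u) a (f v)]

lemma eventually_linked (hf : Continuous f) (hr : 0 < r) (x : ℂ) :
    ∀ᶠ y in 𝓝 x, Linked f r x y := by
  have hopen : IsOpen (f ⁻¹' ball (f x) (r / 2)) := isOpen_ball.preimage hf
  have hx : x ∈ f ⁻¹' ball (f x) (r / 2) := mem_ball_self (half_pos hr)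
  filter_upwards [hopen.connectedComponentIn.mem_nhds (mem_connectedComponentIn hx)] with y hy
  refine ⟨_, isPreconnected_connectedComponentIn, mem_connectedComponentIn hx, hy,
    fun u hu v hv => ?_⟩
  have h1 : dist (f u) (f x) < r / 2 :=
    connectedComponentIn_subset (f ⁻¹' ball (f x) (r / 2)) x hu
  have h2 : dist (f v) (f x) < r / 2 :=
    connectedComponentIn_subset (f ⁻¹' ball (f x) (r / 2)) x hv
  rw [dist_comm] at h2
  linarith [dist_triangle (f u) (f x) (f v)]

end Linked

/-- The point of the square grid of mesh `ε` with given integer coordinates. -/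
def gridPoint (ε : ℝ) (v : ℤ × ℤ) : ℂ := ⟨v.1 * ε, v.2 * ε⟩

/-- Being a grid point of one of the grid squares around `z`. -/
def GridNear (ε : ℝ) (v : ℤ × ℤ) (z : ℂ) : Prop :=
  |v.1 * ε - z.re| < ε ∧ |v.2 * ε - z.im| < ε

section Grid

variable {ε : ℝ}

lemma GridNear.dist_lt {v : ℤ × ℤ} {z : ℂ} (h : GridNear ε v z) :
    dist (gridPoint ε v) z < 2 * ε := by
  rw [dist_eq_norm]
  refine (Complex.norm_le_abs_re_add_abs_im _).trans_lt ?_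
  simp only [gridPoint, Complex.sub_re, Complex.sub_im]
  linarith [h.1, h.2]

lemma exists_gridNear (hε : 0 < ε) (z : ℂ) : ∃ v, GridNear ε v z := by
  have key : ∀ x : ℝ, |⌊x / ε⌋ * ε - x| < ε := fun x => by
    have h1 := (le_div_iff₀ hε).1 (Int.floor_le (x / ε))
    have h2 := (div_lt_iff₀ hε).1 (Int.lt_floor_add_one (x / ε))
    rw [abs_lt]; constructor <;> linarith
  exact ⟨(⌊z.re / ε⌋, ⌊z.im / ε⌋), key _, key _⟩

lemma isOpen_gridNear (v : ℤ × ℤ) : IsOpen {z | GridNear ε v z} := by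
  exact (isOpen_lt (continuous_const.sub Complex.continuous_re).abs continuous_const).inter
    (isOpen_lt (continuous_const.sub Complex.continuous_im).abs continuous_const)

lemma LatticeAdj.dist_lt {v w : ℤ × ℤ} (h : LatticeAdj v w) (hε : 0 < ε) :
    dist (gridPoint ε v) (gridPoint ε w) < 3 * ε := by
  rw [dist_eq_norm]
  refine (Complex.norm_le_abs_re_add_abs_im _).trans_lt ?_
  simp only [gridPoint, Complex.sub_re, Complex.sub_im]
  rcases h.cases with ⟨h1, h2⟩ | ⟨h1, h2⟩ | ⟨h1, h2⟩ | ⟨h1, h2⟩ | ⟨h1, h2⟩ | ⟨h1, h2⟩ <;>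
    rw [h1, h2] <;> push_cast <;> ring_nf <;> simp [abs_of_pos hε] <;> linarith

lemma GridNear.abs_sub_le {v w : ℤ × ℤ} {z : ℂ} (h : GridNear ε v z) (hw : GridNear ε w z) :
    |v.1 - w.1| ≤ 1 ∧ |v.2 - w.2| ≤ 1 := by
  have key : ∀ (a b : ℤ) (x : ℝ), |a * ε - x| < ε → |b * ε - x| < ε → |a - b| ≤ 1 := by
    intro a b x ha hb
    have hε : 0 < ε := (abs_nonneg _).trans_lt ha
    rw [abs_lt] at ha hb
    have h1 : ((a - b : ℤ) : ℝ) < 2 := by push_cast; nlinarith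
    have h2 : (-2 : ℝ) < (a - b : ℤ) := by push_cast; nlinarith
    have h1' : a - b < 2 := by exact_mod_cast h1
    have h2' : -2 < a - b := by exact_mod_cast h2
    rw [abs_le]; omega
  exact ⟨key _ _ _ h.1 hw.1, key _ _ _ h.2 hw.2⟩

/-- Two grid points near `z` are equal, adjacent, or have a common neighbour near `z`. -/
lemma GridNear.eq_or_adj {v w : ℤ × ℤ} {z : ℂ} (h : GridNear ε v z) (h' : GridNear ε w z) :
    v = w ∨ LatticeAdj v w ∨ ∃ u, GridNear ε u z ∧ LatticeAdj v u ∧ LatticeAdj u w := by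
  obtain ⟨h1, h2⟩ := h.abs_sub_le h'
  obtain ⟨a, b⟩ := v
  obtain ⟨c, d⟩ := w
  simp only [abs_le] at h1 h2
  have e1 : c = a - 1 ∨ c = a ∨ c = a + 1 := by omega
  have e2 : d = b - 1 ∨ d = b ∨ d = b + 1 := by omega
  have hd : ∀ {p q : ℤ × ℤ} (i : ZMod 6), q.1 = p.1 + (hexDir i).1 → q.2 = p.2 + (hexDir i).2 →
      LatticeAdj p q := fun i h h' => ⟨i, Prod.ext h h'⟩
  rcases e1 with rfl | rfl | rfl <;> rcases e2 with rfl | rfl | rfl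
  · exact .inr (.inr ⟨(a - 1, b), ⟨h'.1, h.2⟩, hd 3 rfl (add_zero b).symm,
      hd 4 (add_zero _).symm rfl⟩)
  · exact .inr (.inl (hd 3 rfl (add_zero _).symm))
  · exact .inr (.inl (hd 2 rfl rfl))
  · exact .inr (.inl (hd 4 (add_zero _).symm rfl))
  · exact .inl rfl
  · exact .inr (.inl (hd 1 (add_zero _).symm rfl))
  · exact .inr (.inl (hd 5 rfl rfl))
  · exact .inr (.inl (hd 0 rfl (add_zero _).symm))
  · exact .inr (.inr ⟨(a + 1, b), ⟨h'.1, h.2⟩, hd 0 rfl (add_zero _).symm,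
      hd 1 (add_zero _).symm rfl⟩)

end Grid

open Relation in
/-- A continuous map univalently covering small disks around a lattice region without holes is
injective on connected sets mapped well inside the region. -/
lemma injOn_of_lattice {f : ℂ → ℂ} (hf : Continuous f) {K : Set ℂ} {ε : ℝ} (hε : 0 < ε)
    {Q : Set (ℤ × ℤ)} (hfin : Q.Finite)
    (hQ : ∀ c d, c ∉ Q → d ∉ Q → ReflTransGen (fun v w => LatticeAdj v w ∧ w ∉ Q) c d)
    (hnear : ∀ v, ∀ z ∈ K, GridNear ε v z → v ∈ Q)
    (hgQ : ∀ v ∈ Q, ∀ r ≤ 20 * ε, UnivalentlyCovers f (ball (gridPoint ε v) r))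
    (hgK : ∀ k ∈ K, UnivalentlyCovers f (ball k (8 * ε)))
    {C : Set ℂ} (hC : IsPreconnected C) (hCK : MapsTo f C K) : InjOn f C := by
  let E := {p : ℂ × (ℤ × ℤ) // p.2 ∈ Q ∧ f p.1 = gridPoint ε p.2}
  let π : E → ℤ × ℤ := fun e => e.1.2
  let T : E → E → Prop := fun a b => LatticeAdj (π a) (π b) ∧ Linked f (6 * ε) a.1.1 b.1.1
  have hsymm : ∀ a b, T a b → T b a := fun a b h => ⟨h.1.symm, h.2.symm⟩
  have heq : ∀ (a b : E) (r : ℝ), r ≤ 20 * ε → π a = π b → Linked f r a.1.1 b.1.1 → a = b := by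
    intro a b r hr hab hl
    have hfab : f a.1.1 = f b.1.1 := by
      rw [a.2.2, b.2.2]; exact congrArg _ hab
    refine Subtype.ext (Prod.ext (hl.eq hfab ?_) hab)
    rw [a.2.2]; exact hgQ _ a.2.1 r hr
  have hlift : ∀ (y : E) (w : ℤ × ℤ), w ∈ Q → LatticeAdj (π y) w →
      ∃ y' : E, π y' = w ∧ T y y' := by
    intro y w hw hadj
    obtain ⟨z, hz, hl⟩ := (hgQ _ y.2.1 (3 * ε) (by linarith)).exists_linked (x := y.1.1)
      (w := gridPoint ε w) (by rw [y.2.2]; exact mem_ball_self (by linarith))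
      (mem_ball'.2 (hadj.dist_lt hε))
    exact ⟨⟨(z, w), hw, hz⟩, rfl, hadj, hl.mono (by linarith)⟩
  have huniq : ∀ y a b, T y a → T y b → π a = π b → a = b := fun y a b ha hb hab =>
    heq a b _ (by linarith) hab (ha.2.symm.trans hb.2)
  have hadj_of : ∀ (a c : E) (r : ℝ), r ≤ 14 * ε → Linked f r a.1.1 c.1.1 →
      LatticeAdj (π a) (π c) → T a c := by
    intro a c r hr hl hac
    obtain ⟨c', hc', hT⟩ := hlift a (π c) c.2.1 hac
    obtain rfl : c' = c := heq c' c (6 * ε + r) (by linarith) hc' (hT.2.symm.trans hl)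
    exact hT
  have hflat : ∀ a b c, T a b → T b c → LatticeAdj (π a) (π c) → T a c := fun a b c hab hbc =>
    hadj_of a c _ (by linarith) (hab.2.trans hbc.2)
  have hmono : ∀ {s s' : E}, ReflTransGen (fun a b => T a b ∧ π b ∈ Q) s s' → π s = π s' →
      s = s' := fun {s s'} h hss =>
    lattice_monodromy hsymm (fun _ _ h => h.1) hlift huniq hflat _ rfl hfin subset_rfl hQ
      s.2.1 h hss
  have hex : ∀ z, f z ∈ K → ∀ v, GridNear ε v (f z) →
      ∃ e : E, π e = v ∧ Linked f (4 * ε) e.1.1 z := by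
    intro z hz v hv
    have hvQ := hnear v _ hz hv
    obtain ⟨y, hy, hl⟩ := (hgQ v hvQ (2 * ε) (by linarith)).exists_linked (x := z)
      (w := gridPoint ε v) (mem_ball'.2 hv.dist_lt) (mem_ball_self (by linarith))
    exact ⟨⟨(y, v), hvQ, hy⟩, rfl, hl.symm.mono (by linarith)⟩
  have hreach : ∀ z, f z ∈ K → ∀ e e' : E, GridNear ε (π e) (f z) → GridNear ε (π e') (f z) →
      Linked f (5 * ε) e.1.1 z → Linked f (5 * ε) e'.1.1 z →
      ReflTransGen (fun a b => T a b ∧ π b ∈ Q) e e' := by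
    intro z hz e e' hv hv' hl hl'
    have hl2 := hl.trans hl'.symm
    rcases hv.eq_or_adj hv' with h | h | ⟨u, hu, h1, h2⟩
    · rw [heq e e' _ (by linarith) h hl2]
    · exact .single ⟨hadj_of e e' _ (by linarith) hl2 h, e'.2.1⟩
    · obtain ⟨m, rfl, hm⟩ := hex z hz u hu
      exact .tail (.single ⟨hadj_of e m _ (by linarith) (hl.trans hm.symm) h1, m.2.1⟩)
        ⟨hadj_of m e' _ (by linarith) (hm.trans hl'.symm) h2, e'.2.1⟩
  let N : ℂ → E → Prop := fun z e => GridNear ε (π e) (f z) ∧ Linked f (4 * ε) e.1.1 z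
  have hN : ∀ z ∈ C, ∃ e, N z e := by
    intro z hz
    obtain ⟨v, hv⟩ := exists_gridNear hε (f z)
    obtain ⟨e, rfl, he⟩ := hex z (hCK hz) v hv
    exact ⟨e, hv, he⟩
  have hsym' : ∀ {a b : E}, ReflTransGen (fun a b => T a b ∧ π b ∈ Q) a b →
      ReflTransGen (fun a b => T a b ∧ π b ∈ Q) b a := fun {a b} h =>
    (reach_symm hsymm (p := fun b => π b ∈ Q) a.2.1 h).2
  have hconn : ∀ {x x'}, x ∈ C → x' ∈ C → ∀ e e', N x e → N x' e' →
      ReflTransGen (fun a b => T a b ∧ π b ∈ Q) e e' := by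
    intro x x' hx hx'
    refine hC.induction₂' (fun x x' => ∀ e e', N x e → N x' e' →
      ReflTransGen (fun a b => T a b ∧ π b ∈ Q) e e') ?_ ?_ hx hx'
    · intro x hx
      obtain ⟨e₀, h₀, hl₀⟩ := hN x hx
      have hnear' : ∀ᶠ y in 𝓝 x, GridNear ε (π e₀) (f y) :=
        ((isOpen_gridNear _).preimage hf).mem_nhds h₀
      filter_upwards [mem_nhdsWithin_of_mem_nhds hnear',
        mem_nhdsWithin_of_mem_nhds (eventually_linked hf hε x), self_mem_nhdsWithin]
        with y hy1 hy2 hyC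
      have key : ∀ e e', N x e → N y e' → ReflTransGen (fun a b => T a b ∧ π b ∈ Q) e e' :=
        fun e e' he he' =>
        (hreach x (hCK hx) e e₀ he.1 h₀ (he.2.mono (by linarith)) (hl₀.mono (by linarith))).trans
        (hreach y (hCK hyC) e₀ e' hy1 he'.1 ((hl₀.trans hy2).mono (by linarith))
          (he'.2.mono (by linarith)))
      exact ⟨key, fun e e' he he' => hsym' (key e' e he' he)⟩
    · intro x y z _ hy _ hxy hyz e e' he he'
      obtain ⟨m, hm⟩ := hN y hy
      exact (hxy e m he hm).trans (hyz m e' hm he')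
  intro x hx x' hx' hxx
  obtain ⟨v, hv⟩ := exists_gridNear hε (f x)
  obtain ⟨e, he, hel⟩ := hex x (hCK hx) v hv
  obtain ⟨e', he', hel'⟩ := hex x' (hCK hx') v (hxx ▸ hv)
  obtain rfl := hmono (hconn hx hx' e e' ⟨he ▸ hv, hel⟩ ⟨he' ▸ hxx ▸ hv, hel'⟩)
    (he.trans he'.symm)
  exact ((hel.symm.trans hel').mono (by linarith : 4 * ε + 4 * ε ≤ 8 * ε)).eq hxx
    (hgK _ (hCK hx))

lemma isPreconnected_lt_norm (R : ℝ) (hR : 0 < R) : IsPreconnected {z : ℂ | R < ‖z‖} := by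
  have : {z : ℂ | R < ‖z‖} = Complex.exp '' {z | Real.log R < z.re} := by
    ext z
    constructor
    · intro (hz : R < ‖z‖)
      have hz0 : z ≠ 0 := norm_pos_iff.1 (hR.trans hz)
      exact ⟨Complex.log z, by simpa [Complex.log_re] using Real.log_lt_log hR hz,
        Complex.exp_log hz0⟩
    · rintro ⟨w, hw, rfl⟩
      simpa [Complex.norm_exp] using (Real.log_lt_iff_lt_exp hR).1 hw
  rw [this]
  exact (convex_halfSpace_re_gt _).isPreconnected.image _ Complex.continuous_exp.continuousOn

/-- If the complement of a compact set `K` is connected, then the points at distance at least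
`δ` from `K` are joined by a connected set that stays away from `K`. -/
lemma exists_isPreconnected_far {K : Set ℂ} (hK : IsCompact K) (hne : K.Nonempty)
    (hKc : IsConnected Kᶜ) {δ : ℝ} (hδ : 0 < δ) :
    ∃ η > 0, ∃ M, IsPreconnected M ∧ (∀ z ∈ M, η < infDist z K) ∧
      ∀ z, δ ≤ infDist z K → z ∈ M := by
  obtain ⟨R, hR0, hR⟩ := hK.isBounded.exists_pos_norm_lt
  have hfar : ∀ z : ℂ, R + 2 < ‖z‖ → 1 < infDist z K := by
    intro z hz
    obtain ⟨k, hk, hkd⟩ := hK.exists_infDist_eq_dist hne z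
    rw [hkd, dist_eq_norm]
    linarith [hR k hk, norm_sub_norm_le z k]
  have hSc := isPreconnected_lt_norm (R + 2) (by linarith)
  obtain ⟨p, hp⟩ : ∃ p : ℂ, R + 2 < ‖p‖ := ⟨((R + 3 : ℝ) : ℂ), by
    rw [Complex.norm_real, Real.norm_of_nonneg] <;> linarith⟩
  set F : ℕ → Set ℂ := fun n => {z | 1 / ((n : ℝ) + 1) < infDist z K} with hF
  have hFo : ∀ n, IsOpen (F n) := fun n => isOpen_lt continuous_const (continuous_infDist_pt K)
  have hF1 : ∀ n : ℕ, 1 / ((n : ℝ) + 1) ≤ 1 := fun n => by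
    rw [div_le_one (by positivity)]; linarith [n.cast_nonneg (α := ℝ)]
  have hpF : ∀ n, p ∈ F n := fun n => (hF1 n).trans_lt (hfar p hp)
  have hFmono : Monotone F := by
    intro m n hmn z hz
    have : (m : ℝ) ≤ n := by exact_mod_cast hmn
    have h : 1 / ((n : ℝ) + 1) ≤ 1 / (m + 1) :=
      one_div_le_one_div_of_le (by positivity) (by linarith)
    exact h.trans_lt hz
  have hcover : ∀ x ∈ Kᶜ, ∃ n, x ∈ connectedComponentIn (F n) p := by
    intro x hx
    have hpK : p ∈ Kᶜ := fun h => by linarith [hR p h]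
    have hpath := (hK.isClosed.isOpen_compl.isConnected_iff_isPathConnected.1 hKc).joinedIn
      p hpK x hx
    obtain ⟨γ, hγ⟩ := hpath
    have hcpt : IsCompact (range γ) := isCompact_range γ.continuous
    obtain ⟨m, ⟨t, rfl⟩, hmin⟩ := hcpt.exists_isMinOn ⟨_, mem_range_self 0⟩
      (continuous_infDist_pt K).continuousOn
    have hpos : 0 < infDist (γ t) K :=
      (hK.isClosed.notMem_iff_infDist_pos hne).1 (hγ t)
    obtain ⟨n, hn⟩ := exists_nat_one_div_lt hpos
    refine ⟨n, (isPreconnected_range γ.continuous).subset_connectedComponentIn ⟨0, by simp⟩ ?_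
      ⟨1, by simp⟩⟩
    rintro _ ⟨s, rfl⟩
    exact hn.trans_le (hmin (mem_range_self s))
  have hD : IsCompact ({z | δ ≤ infDist z K} ∩ closedBall (0 : ℂ) (R + 2)) :=
    (isCompact_closedBall _ _).inter_left
      (isClosed_le continuous_const (continuous_infDist_pt K))
  obtain ⟨n, hn⟩ := hD.elim_directed_cover (fun n => connectedComponentIn (F n) p)
    (fun n => (hFo n).connectedComponentIn)
    (fun z hz => mem_iUnion.2 (hcover z fun hzK => by
      have := hz.1.trans_eq (infDist_zero_of_mem hzK)
      linarith))
    (Monotone.directed_le fun m n hmn => connectedComponentIn_mono p (hFmono hmn))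
  refine ⟨1 / (n + 1), by positivity, connectedComponentIn (F n) p,
    isPreconnected_connectedComponentIn, fun z hz => connectedComponentIn_subset (F n) p hz,
    fun z hz => ?_⟩
  by_cases hzR : ‖z‖ ≤ R + 2
  · exact hn ⟨hz, by simpa using hzR⟩
  · exact hSc.subset_connectedComponentIn hp
      (fun w hw => (hF1 n).trans_lt (hfar w hw)) (not_le.1 hzR)

open Relation in
/-- The grid points near a connected set are connected in the lattice. -/
lemma reach_of_gridNear {ε : ℝ} (hε : 0 < ε) {M : Set ℂ} (hM : IsPreconnected M)
    {v w : ℤ × ℤ} {x y : ℂ} (hx : x ∈ M) (hy : y ∈ M) (hv : GridNear ε v x)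
    (hw : GridNear ε w y) :
    ReflTransGen (fun v w => LatticeAdj v w ∧ ∃ z ∈ M, GridNear ε w z) v w := by
  have hloc : ∀ z ∈ M, ∀ v w, GridNear ε v z → GridNear ε w z →
      ReflTransGen (fun v w => LatticeAdj v w ∧ ∃ z ∈ M, GridNear ε w z) v w := by
    intro z hz v w hv hw
    rcases hv.eq_or_adj hw with rfl | h | ⟨u, hu, h1, h2⟩
    · exact .refl
    · exact .single ⟨h, z, hz, hw⟩
    · exact .tail (.single ⟨h1, z, hz, hu⟩) ⟨h2, z, hz, hw⟩
  refine hM.induction₂' (fun x y => ∀ v w, GridNear ε v x → GridNear ε w y →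
    ReflTransGen (fun v w => LatticeAdj v w ∧ ∃ z ∈ M, GridNear ε w z) v w) ?_ ?_ hx hy v w hv hw
  · intro x hx
    obtain ⟨u, hu⟩ := exists_gridNear hε x
    filter_upwards [mem_nhdsWithin_of_mem_nhds ((isOpen_gridNear u).mem_nhds hu),
      self_mem_nhdsWithin] with y hy hyM
    exact ⟨fun v w hv hw => (hloc x hx v u hv hu).trans (hloc y hyM u w hy hw),
      fun v w hv hw => (hloc y hyM v u hv hy).trans (hloc x hx u w hu hw)⟩
  · intro x y z _ hy _ hxy hyz v w hv hw
    obtain ⟨u, hu⟩ := exists_gridNear hε y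
    exact (hxy v u hv hu).trans (hyz u w hu hw)

open Relation in
/-- A continuous map univalently covering the small disks near a compact set with connected
complement is injective on connected sets mapped into it. -/
theorem injOn_of_univalentlyCovers {f : ℂ → ℂ} (hf : Continuous f) {K : Set ℂ}
    (hK : IsCompact K) (hKc : IsConnected Kᶜ) {δ : ℝ} (hδ : 0 < δ)
    (hg : ∀ k ∈ K, ∀ a r, ball a r ⊆ ball k δ → UnivalentlyCovers f (ball a r))
    {C : Set ℂ} (hC : IsPreconnected C) (hCK : MapsTo f C K) : InjOn f C := by
  rcases K.eq_empty_or_nonempty with rfl | hne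
  · intro x hx
    exact (hCK hx).elim
  obtain ⟨η, hη, M, hM, hMη, hMδ⟩ := exists_isPreconnected_far hK hne hKc (half_pos hδ)
  set ε := min (η / 4) (δ / 100) with hε_def
  have hε : 0 < ε := by positivity
  have hεη : ε ≤ η / 4 := min_le_left _ _
  have hεδ : ε ≤ δ / 100 := min_le_right _ _
  set Q : Set (ℤ × ℤ) := {v | ∃ z ∈ M, GridNear ε v z}ᶜ with hQ
  have hself : ∀ v, GridNear ε v (gridPoint ε v) := fun v => by
    simp [GridNear, gridPoint, hε]
  have hQdist : ∀ v ∈ Q, infDist (gridPoint ε v) K < δ / 2 := fun v hv => by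
    by_contra! h
    exact hv ⟨_, hMδ _ h, hself v⟩
  refine injOn_of_lattice hf hε (Q := Q) ?_ ?_ ?_ ?_ ?_ hC hCK
  · obtain ⟨R, hR0, hR⟩ := hK.isBounded.exists_pos_norm_lt
    obtain ⟨N, hN⟩ := exists_nat_gt ((R + δ) / ε)
    rw [div_lt_iff₀ hε] at hN
    refine (finite_Icc ((-N : ℤ), (-N : ℤ)) ((N : ℤ), (N : ℤ))).subset fun v hv => ?_
    obtain ⟨k, hk, hkd⟩ := (infDist_lt_iff hne).1 (hQdist v hv)
    have hnorm : ‖gridPoint ε v‖ ≤ N * ε := by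
      rw [dist_eq_norm] at hkd
      linarith [norm_sub_norm_le (gridPoint ε v) k, hR k hk]
    have key : ∀ a : ℤ, |a * ε| ≤ N * ε → -(N : ℤ) ≤ a ∧ a ≤ N := by
      intro a ha
      rw [abs_mul, abs_of_pos hε] at ha
      have := le_of_mul_le_mul_right ha hε
      exact abs_le.1 (by exact_mod_cast this)
    have h1 := key v.1 ((Complex.abs_re_le_norm (gridPoint ε v)).trans hnorm)
    have h2 := key v.2 ((Complex.abs_im_le_norm (gridPoint ε v)).trans hnorm)
    exact ⟨⟨h1.1, h2.1⟩, ⟨h1.2, h2.2⟩⟩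
  · intro c d hc hd
    simp only [hQ, mem_compl_iff, not_not, mem_ofPred_eq] at hc hd ⊢
    obtain ⟨x, hx, hcx⟩ := hc
    obtain ⟨y, hy, hdy⟩ := hd
    exact reach_of_gridNear hε hM hx hy hcx hdy
  · rintro v k hk hv ⟨z, hz, hvz⟩
    have h1 := (hMη z hz).trans_le (infDist_le_dist_of_mem hk)
    have h2 := dist_triangle_left z k (gridPoint ε v)
    linarith [hv.dist_lt, hvz.dist_lt]
  · intro v hv r hr
    obtain ⟨k, hk, hkd⟩ := (infDist_lt_iff hne).1 (hQdist v hv)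
    exact hg k hk _ _ (ball_subset_ball' (by linarith))
  · intro k hk
    exact hg k hk _ _ (ball_subset_ball (by linarith))

/-! ### Hidden components -/

lemma isOpenMap_of_image_eq {f : ℂ → ℂ} (hf : Differentiable ℂ f) {Δ : Set ℂ} (hΔo : IsOpen Δ)
    (hne : Δ.Nonempty) (hfΔ : f '' Δ = Δ) : IsOpenMap f := by
  have han : AnalyticOnNhd ℂ f univ := fun z _ => hf.analyticAt z
  rcases han.is_constant_or_isOpen isPreconnected_univ with ⟨w, hw⟩ | h
  · exfalso
    have hΔ : Δ ⊆ {w} := by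
      rw [← hfΔ]
      rintro _ ⟨z, -, rfl⟩
      exact hw z trivial
    obtain rfl : Δ = {w} := (subset_singleton_iff_eq.1 hΔ).resolve_left hne.ne_empty
    exact not_isOpen_singleton w hΔo
  · exact fun s hs => h s (subset_univ s) hs

/-- Small disks inside a neighbourhood certifying that a point is not a singular value are
univalently covered. -/
lemma exists_nhds_univalentlyCovers {f : ℂ → ℂ} (hf : Continuous f) (hfo : IsOpenMap f) {v : ℂ}
    (hv : ¬ IsSingularValue f v) :
    ∃ V, IsOpen V ∧ v ∈ V ∧ ∀ a r, ball a r ⊆ V → UnivalentlyCovers f (ball a r) := by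
  simp only [IsSingularValue, not_forall, not_exists, not_and, not_not] at hv
  obtain ⟨V, hVo, hvV, hV⟩ := hv
  refine ⟨V, hVo, hvV, fun a r hB => ⟨fun C hC hCB x hx => ?_, fun x hx => ?_⟩⟩
  · have hsub : C ⊆ connectedComponentIn (f ⁻¹' V) x :=
      hC.subset_connectedComponentIn hx (hCB.trans (preimage_mono hB))
    exact ((hV x (hB (hCB hx))).1.mono hsub) hx
  · have hxV : x ∈ f ⁻¹' V := hB hx
    set D := connectedComponentIn (f ⁻¹' V) x with hD
    have hDo : IsOpen D := (hVo.preimage hf).connectedComponentIn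
    obtain ⟨hinj, himg⟩ := hV x hxV
    have hpre : IsPreconnected (D.domRestrict f ⁻¹' ball a r) := by
      refine (convex_ball a r).isPreconnected.preimage_of_isOpenMap (injOn_iff_injective.1 hinj)
        (hfo.domRestrict hDo) ?_
      rw [range_domRestrict, himg]
      exact hB
    refine ⟨Subtype.val '' (D.domRestrict f ⁻¹' ball a r),
      hpre.image _ continuous_subtype_val.continuousOn,
      ⟨⟨x, mem_connectedComponentIn hxV⟩, hx, rfl⟩, ?_, fun w hw => ?_⟩
    · rintro _ ⟨y, hy, rfl⟩
      exact hy
    · obtain ⟨y, hy, rfl⟩ := himg.symm.subset (hB hw)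
      exact ⟨y, ⟨⟨y, hy⟩, hw, rfl⟩, rfl⟩

section Hat

variable {X : Set ℂ}

/-- A point of a bounded complementary component of the closure of `X`. -/
def IsHidden (X : Set ℂ) (z : ℂ) : Prop :=
  z ∉ closure X ∧ IsBounded (connectedComponentIn (closure X)ᶜ z)

lemma closure_component_subset (z : ℂ) :
    closure (connectedComponentIn (closure X)ᶜ z) ⊆
      connectedComponentIn (closure X)ᶜ z ∪ closure X := by
  intro w hw
  by_cases hwX : w ∈ closure X
  · exact .inr hwX
  left
  have hopen : IsOpen (connectedComponentIn (closure X)ᶜ w) :=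
    isClosed_closure.isOpen_compl.connectedComponentIn
  obtain ⟨y, hy1, hy2⟩ := mem_closure_iff.1 hw _ hopen (mem_connectedComponentIn hwX)
  rw [connectedComponentIn_eq hy2, ← connectedComponentIn_eq hy1]
  exact mem_connectedComponentIn hwX

lemma compl_hat_eq (hX : IsBounded X) : ∃ p, p ∉ closure X ∧
    (hat X)ᶜ = connectedComponentIn (closure X)ᶜ p ∧
    ¬ IsBounded (connectedComponentIn (closure X)ᶜ p) ∧ IsBounded (hat X) := by
  obtain ⟨R, hR0, hR⟩ := hX.closure.exists_pos_norm_lt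
  have hS := isPreconnected_lt_norm R hR0
  have hSX : {z : ℂ | R < ‖z‖} ⊆ (closure X)ᶜ := fun z (hz : R < ‖z‖) h => (hR z h).not_gt hz
  have hSb : ¬ IsBounded {z : ℂ | R < ‖z‖} := by
    intro h
    obtain ⟨M, hM0, hM⟩ := h.exists_pos_norm_lt
    have h0 : 0 ≤ R + M := by linarith
    have h1 : ‖((R + M : ℝ) : ℂ)‖ = R + M := by
      rw [Complex.norm_real, Real.norm_of_nonneg h0]
    have := hM ((R + M : ℝ) : ℂ) (by rw [mem_ofPred_eq, h1]; linarith)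
    linarith
  have hfar : ∀ z : ℂ, R < ‖z‖ → ¬ IsBounded (connectedComponentIn (closure X)ᶜ z) :=
    fun z hz hb => hSb (hb.subset (hS.subset_connectedComponentIn hz hSX))
  set p : ℂ := ((R + 1 : ℝ) : ℂ) with hp
  have hpR : R < ‖p‖ := by
    rw [hp, Complex.norm_real, Real.norm_of_nonneg] <;> linarith
  have hpX : p ∉ closure X := hSX hpR
  refine ⟨p, hpX, ?_, hfar p hpR, ?_⟩
  · ext z
    simp only [hat, mem_compl_iff, mem_union, mem_ofPred_eq, not_or, not_and]
    constructor
    · rintro ⟨hzX, hz⟩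
      have hzb := hz hzX
      have : ∃ w ∈ connectedComponentIn (closure X)ᶜ z, R < ‖w‖ := by
        by_contra! h
        exact hzb ((isBounded_closedBall (x := (0 : ℂ)) (r := R)).subset
          fun w hw => by simpa using h w hw)
      obtain ⟨w, hw, hwR⟩ := this
      have hwp : w ∈ connectedComponentIn (closure X)ᶜ p :=
        hS.subset_connectedComponentIn hpR hSX hwR
      rw [connectedComponentIn_eq hwp, ← connectedComponentIn_eq hw]
      exact mem_connectedComponentIn hzX
    · intro hz
      refine ⟨connectedComponentIn_subset (closure X)ᶜ p hz, fun _ => ?_⟩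
      rw [← connectedComponentIn_eq hz]
      exact hfar p hpR
  · refine (isBounded_closedBall (x := (0 : ℂ)) (r := R)).subset ?_
    rintro z (hz | hz)
    · simpa using (hR z hz).le
    · by_contra h
      exact hfar z (by simpa using h) hz.2

lemma isConnected_compl_hat (hX : IsBounded X) : IsConnected (hat X)ᶜ := by
  obtain ⟨p, hp, h, -⟩ := compl_hat_eq hX
  rw [h]
  exact isConnected_connectedComponentIn_iff.2 hp

lemma isCompact_hat (hX : IsBounded X) : IsCompact (hat X) := by
  obtain ⟨p, hp, h, -, hb⟩ := compl_hat_eq hX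
  refine Metric.isCompact_of_isClosed_isBounded ⟨?_⟩ hb
  rw [h]
  exact isClosed_closure.isOpen_compl.connectedComponentIn

lemma not_isBounded_compl_hat (hX : IsBounded X) : ¬ IsBounded (hat X)ᶜ := by
  obtain ⟨p, -, h, h', -⟩ := compl_hat_eq hX
  rwa [h]

lemma IsHidden.of_mem {z w : ℂ} (hz : IsHidden X z)
    (hw : w ∈ connectedComponentIn (closure X)ᶜ z) : IsHidden X w :=
  ⟨connectedComponentIn_subset (closure X)ᶜ z hw, connectedComponentIn_eq hw ▸ hz.2⟩

end Hat

/-- Without singular values in the hat, an entire map is injective on connected subsets of the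
preimage of the hat. -/
lemma injOn_of_mapsTo_hat {f : ℂ → ℂ} (hf : Continuous f) (hfo : IsOpenMap f) {Δ : Set ℂ}
    (hb : IsBounded Δ) (hs : {s | IsSingularValue f s} ∩ hat Δ = ∅) {C : Set ℂ}
    (hC : IsPreconnected C) (hCK : MapsTo f C (hat Δ)) : InjOn f C := by
  have hns : ∀ k : hat Δ, ¬ IsSingularValue f k := fun k h =>
    (hs.subset ⟨h, k.2⟩ : _ ∈ (∅ : Set ℂ))
  choose V hVo hV hVB using fun k => exists_nhds_univalentlyCovers hf hfo (hns k)
  obtain ⟨δ, hδ, hδV⟩ := lebesgue_number_lemma_of_metric (isCompact_hat hb) hVo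
    fun k hk => mem_iUnion.2 ⟨⟨k, hk⟩, hV ⟨k, hk⟩⟩
  refine injOn_of_univalentlyCovers hf (isCompact_hat hb) (isConnected_compl_hat hb) hδ
    (fun k hk a r har => ?_) hC hCK
  obtain ⟨i, hi⟩ := hδV k hk
  exact hVB i a r (har.trans hi)

section Dynamics

variable {f : ℂ → ℂ} {Δ : Set ℂ}

lemma image_closure_eq (hf : Continuous f) (hb : IsBounded Δ) (hfΔ : f '' Δ = Δ) :
    f '' closure Δ = closure Δ := by
  refine ((image_closure_subset_closure_image hf).trans_eq (by rw [hfΔ])).antisymm ?_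
  have hc : IsCompact (f '' closure Δ) := hb.isCompact_closure.image hf
  refine closure_minimal ?_ hc.isClosed
  conv_lhs => rw [← hfΔ]
  exact image_mono subset_closure

/-- The image of a hidden component lies in a hidden component. -/
lemma IsHidden.map (hf : Continuous f) (hfo : IsOpenMap f) (hΔc : IsConnected Δ)
    (hb : IsBounded Δ) (hfΔ : f '' Δ = Δ) (hs : {s | IsSingularValue f s} ∩ hat Δ = ∅)
    {z : ℂ} (hz : IsHidden Δ z) : IsHidden Δ (f z) := by
  set X := closure Δ with hX
  set H := connectedComponentIn Xᶜ z with hH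
  have hfX : f '' X = X := image_closure_eq hf hb hfΔ
  have hHo : IsOpen H := isClosed_closure.isOpen_compl.connectedComponentIn
  have hzH : z ∈ H := mem_connectedComponentIn hz.1
  have hclH : closure H ⊆ H ∪ X := closure_component_subset z
  have hfHb : IsBounded (f '' closure H) := (hz.2.isCompact_closure.image hf).isBounded
  have hHK : MapsTo f H (hat Δ) := by
    intro h hh
    by_contra hcon
    refine not_isBounded_compl_hat hb (hfHb.subset (Subset.trans ?_ (image_mono subset_closure)))
    refine (isConnected_compl_hat hb).isPreconnected.subset_of_closure_inter_subset (hfo H hHo)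
      ⟨f h, hcon, h, hh, rfl⟩ ?_
    rintro y ⟨hy, hyK⟩
    have hy' : y ∈ f '' closure H :=
      closure_minimal (image_mono subset_closure)
        (hz.2.isCompact_closure.image hf).isClosed hy
    obtain ⟨w, hw, rfl⟩ := hy'
    rcases hclH hw with hw | hw
    · exact ⟨w, hw, rfl⟩
    · exact absurd (.inl (hfX.subset ⟨w, hw, rfl⟩)) hyK
  have hne : (X ∩ closure H).Nonempty := by
    have hHu : H ≠ univ := fun h => by
      obtain ⟨x, hx⟩ := hΔc.nonempty
      exact connectedComponentIn_subset Xᶜ z (h ▸ mem_univ x : x ∈ H) (subset_closure hx)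
    obtain ⟨y, hy⟩ := nonempty_frontier_iff.2 ⟨⟨z, hzH⟩, hHu⟩
    have hyH : y ∉ H := by
      rw [hHo.frontier_eq] at hy
      exact hy.2
    exact ⟨y, (hclH hy.1).resolve_left hyH, hy.1⟩
  obtain ⟨y, hyX, hyH⟩ := hne
  have hconn : IsPreconnected (X ∪ closure H) :=
    hΔc.isPreconnected.closure.union y hyX hyH isPreconnected_connectedComponentIn.closure
  have hmaps : MapsTo f (X ∪ closure H) (hat Δ) := by
    have hXK : MapsTo f X (hat Δ) := fun x hx => .inl (hfX.subset ⟨x, hx, rfl⟩)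
    rintro x (hx | hx)
    · exact hXK hx
    · rcases hclH hx with hx | hx
      · exact hHK hx
      · exact hXK hx
  have hinj := injOn_of_mapsTo_hat hf hfo hb hs hconn hmaps
  rcases hHK hzH with h | h
  · obtain ⟨x, hx, hxz⟩ := hfX.symm.subset h
    have := hinj (.inl hx) (.inr (subset_closure hzH)) hxz
    exact absurd (this ▸ hx) hz.1
  · exact h

lemma IsHidden.iterate (hmap : ∀ z, IsHidden Δ z → IsHidden Δ (f z)) {z : ℂ}
    (hz : IsHidden Δ z) (n : ℕ) : IsHidden Δ (f^[n] z) := by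
  induction n with
  | zero => exact hz
  | succ n ih => rw [Function.iterate_succ_apply']; exact hmap _ ih

end Dynamics

/-! ### The Fatou set -/

section Fatou

variable {f : ℂ → ℂ}

lemma mem_fatouSet_iff {z : ℂ} :
    z ∈ fatouSet f ↔ ∀ᶠ x in 𝓝 z, EquicontinuousAt (fun n : ℕ => f^[n]) x := by
  have key : ∀ {U : Set ℂ}, IsOpen U → (EquicontinuousOn (fun n : ℕ => f^[n]) U ↔
      ∀ x ∈ U, EquicontinuousAt (fun n : ℕ => f^[n]) x) := by
    intro U hU
    refine forall₂_congr fun x hx => ?_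
    rw [EquicontinuousWithinAt, EquicontinuousAt, hU.nhdsWithin_eq hx]
  constructor
  · rintro ⟨U, hU, hUo, h⟩
    exact mem_of_superset hU ((key hUo).1 h)
  · intro h
    obtain ⟨U, hU, hUo, hz⟩ := _root_.eventually_nhds_iff.1 h
    exact ⟨U, hUo.mem_nhds hz, hUo, (key hUo).2 hU⟩

lemma map_mem_fatouSet (hfo : IsOpenMap f) {z : ℂ} (hz : z ∈ fatouSet f) : f z ∈ fatouSet f := by
  rw [mem_fatouSet_iff] at hz ⊢
  refine mem_of_superset (hfo.image_mem_nhds hz) ?_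
  rintro _ ⟨x, hx, rfl⟩
  refine Metric.equicontinuousAt_iff_right.2 fun ε hε => ?_
  refine mem_of_superset (hfo.image_mem_nhds (Metric.equicontinuousAt_iff_right.1 hx ε hε)) ?_
  rintro _ ⟨y, hy, rfl⟩ n
  exact hy (n + 1)

lemma mapsTo_iterate_fatouSet (hfo : IsOpenMap f) (n : ℕ) :
    MapsTo f^[n] (fatouSet f) (fatouSet f) :=
  MapsTo.iterate (fun _ => map_mem_fatouSet hfo) n

/-- Montel's theorem for uniformly bounded iterates. -/
lemma subset_fatouSet_of_isBounded (hf : Differentiable ℂ f) {U B : Set ℂ} (hU : IsOpen U)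
    (hB : IsBounded B) (hUB : ∀ n : ℕ, MapsTo f^[n] U B) : U ⊆ fatouSet f := by
  intro z hz
  rw [mem_fatouSet_iff]
  filter_upwards [hU.mem_nhds hz] with x hx
  obtain ⟨r, hr, hrU⟩ := Metric.isOpen_iff.1 hU x hx
  obtain ⟨M, hM⟩ := Metric.isBounded_iff.1 hB
  refine Metric.equicontinuousAt_of_continuity_modulus (fun y => M / r * dist y x) ?_ _ ?_
  · have : Continuous fun y => M / r * dist y x := by fun_prop
    simpa using this.tendsto x
  · filter_upwards [ball_mem_nhds x hr] with y hy n
    rw [dist_comm]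
    exact Complex.dist_le_div_mul_dist_of_mapsTo_ball (hf.iterate n).differentiableOn
      (fun w hw => hM (hUB n (hrU hw)) (hUB n hx)) hy

lemma image_iterate_component_subset (hf : Continuous f) (hfo : IsOpenMap f) {z : ℂ}
    (hz : z ∈ fatouSet f) (n : ℕ) :
    f^[n] '' connectedComponentIn (fatouSet f) z ⊆
      connectedComponentIn (fatouSet f) (f^[n] z) := by
  refine (isPreconnected_connectedComponentIn.image _
    (hf.iterate n).continuousOn).subset_connectedComponentIn
    ⟨z, mem_connectedComponentIn hz, rfl⟩ ?_
  rintro _ ⟨w, hw, rfl⟩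
  exact mapsTo_iterate_fatouSet hfo n (connectedComponentIn_subset _ _ hw)

lemma component_iterate_eq (hf : Continuous f) (hfo : IsOpenMap f) {z w : ℂ}
    (hz : z ∈ fatouSet f) (hw : w ∈ connectedComponentIn (fatouSet f) z) (n : ℕ) :
    connectedComponentIn (fatouSet f) (f^[n] w) = connectedComponentIn (fatouSet f) (f^[n] z) :=
  (connectedComponentIn_eq (image_iterate_component_subset hf hfo hz n ⟨w, hw, rfl⟩)).symm

/-- Without wandering domains every Fatou component is preperiodic. -/
lemma exists_isPeriodicFatouComponent (hf : Continuous f) (hfo : IsOpenMap f)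
    (hnw : ¬ ∃ U : Set ℂ, IsWanderingDomain f U) {z : ℂ} (hz : z ∈ fatouSet f) :
    ∃ m : ℕ, IsPeriodicFatouComponent f (connectedComponentIn (fatouSet f) (f^[m] z)) := by
  by_contra! hcon
  refine hnw ⟨connectedComponentIn (fatouSet f) z, ⟨z, hz, rfl⟩, fun m n hmn w hw h => ?_⟩
  rw [component_iterate_eq hf hfo hz hw, component_iterate_eq hf hfo hz hw] at h
  refine hcon m ⟨⟨_, mapsTo_iterate_fatouSet hfo m hz, rfl⟩, n - m, by lia, ?_⟩
  refine (image_iterate_component_subset hf hfo (mapsTo_iterate_fatouSet hfo m hz) _).trans ?_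
  rw [← Function.iterate_add_apply, Nat.sub_add_cancel hmn.le, h]

end Fatou

/-- A nonempty bounded open plane set has at least two boundary points. -/
lemma not_subsingleton_of_frontier_subset {H S : Set ℂ} (hH : IsOpen H) (hHb : IsBounded H)
    (hne : H.Nonempty) (hS : frontier H ⊆ S) : ¬ S.Subsingleton := by
  intro hsub
  obtain ⟨p, hp⟩ : ∃ p, S ⊆ {p} := by
    rcases hsub.eq_empty_or_singleton with h | ⟨p, h⟩
    · exact ⟨0, h ▸ empty_subset _⟩
    · exact ⟨p, h.subset⟩
  have hconn : IsPreconnected ({p}ᶜ : Set ℂ) :=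
    (isConnected_compl_singleton_of_one_lt_rank
      (by rw [Complex.rank_real_complex]; exact Nat.one_lt_ofNat) p).isPreconnected
  have hmeet : (({p}ᶜ : Set ℂ) ∩ H).Nonempty := by
    obtain ⟨x, hx⟩ := hne
    by_contra h
    have hHp : H ⊆ {p} := fun y hy => by
      by_contra hyp
      exact h ⟨y, hyp, hy⟩
    have : H = {p} := (subset_singleton_iff_eq.1 hHp).resolve_left (nonempty_of_mem hx).ne_empty
    exact not_isOpen_singleton p (this ▸ hH)
  have hsubH : ({p}ᶜ : Set ℂ) ⊆ H := by
    refine hconn.subset_of_closure_inter_subset hH hmeet ?_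
    rintro x ⟨hx, hxp⟩
    by_contra hxH
    exact hxp (hp (hS (by rw [hH.frontier_eq]; exact ⟨hx, hxH⟩)))
  have : IsBounded (univ : Set ℂ) := by
    rw [← compl_union_self {p}]
    exact (hHb.subset hsubH).union isBounded_singleton
  exact NormedSpace.unbounded_univ ℝ ℂ this

/-- If some component of the complement of the closure is bounded, a fixed Fatou disk without
singular values in its hat has a boundary point in the Fatou set. -/
lemma exists_frontier_mem_fatouSet {f : ℂ → ℂ} (hf : Differentiable ℂ f)
    (hnw : ¬ ∃ U : Set ℂ, IsWanderingDomain f U) (hsep : SeparationProperty f) {Δ : Set ℂ}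
    (hΔo : IsOpen Δ) (hΔc : IsConnected Δ) (hfΔ : f '' Δ = Δ) (hΔF : Δ ⊆ fatouSet f)
    (hb : IsBounded Δ) (hs : {s | IsSingularValue f s} ∩ hat Δ = ∅) {z : ℂ}
    (hz : IsHidden Δ z) : ∃ p ∈ fatouSet f, p ∈ frontier Δ := by
  have hfo : IsOpenMap f := isOpenMap_of_image_eq hf hΔo hΔc.nonempty hfΔ
  have hfc : Continuous f := hf.continuous
  have hmap : ∀ z, IsHidden Δ z → IsHidden Δ (f z) :=
    fun z => IsHidden.map hfc hfo hΔc hb hfΔ hs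
  have hHo : ∀ z, IsOpen (connectedComponentIn (closure Δ)ᶜ z) :=
    fun z => isClosed_closure.isOpen_compl.connectedComponentIn
  have hHF : ∀ {z}, IsHidden Δ z → connectedComponentIn (closure Δ)ᶜ z ⊆ fatouSet f :=
    fun {z} hz => subset_fatouSet_of_isBounded hf (hHo z) (isCompact_hat hb).isBounded
      fun n w hw => .inr (IsHidden.iterate hmap (hz.of_mem hw) n)
  obtain ⟨m, hm⟩ := exists_isPeriodicFatouComponent hfc hfo hnw
    (hHF hz (mem_connectedComponentIn hz.1))
  set h := f^[m] z
  have hh : IsHidden Δ h := IsHidden.iterate hmap hz m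
  have hhH : h ∈ connectedComponentIn (closure Δ)ᶜ h := mem_connectedComponentIn hh.1
  obtain ⟨x, hx⟩ := hΔc.nonempty
  set U := connectedComponentIn (fatouSet f) x with hU
  have hΔU : Δ ⊆ U := hΔc.isPreconnected.subset_connectedComponentIn hx hΔF
  have hUper : IsPeriodicFatouComponent f U := by
    refine ⟨⟨x, hΔF hx, rfl⟩, 1, one_pos, ?_⟩
    refine (image_iterate_component_subset hfc hfo (hΔF hx) 1).trans ?_
    rw [hU, connectedComponentIn_eq (hΔU (hfΔ.subset ⟨x, hx, rfl⟩))]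
    rfl
  have hHW : connectedComponentIn (closure Δ)ᶜ h ⊆ connectedComponentIn (fatouSet f) h :=
    isPreconnected_connectedComponentIn.subset_connectedComponentIn hhH (hHF hh)
  by_cases hUW : U = connectedComponentIn (fatouSet f) h
  · by_contra! hcon
    have hUΔ : U ⊆ Δ := by
      refine isPreconnected_connectedComponentIn.subset_of_closure_inter_subset hΔo
        ⟨x, hΔU hx, hx⟩ ?_
      rintro y ⟨hy, hyU⟩
      by_contra hyΔ
      exact hcon y (connectedComponentIn_subset _ _ hyU) (by rw [hΔo.frontier_eq]; exact ⟨hy, hyΔ⟩)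
    exact absurd (subset_closure (hUΔ (hUW ▸ hHW hhH))) hh.1
  · refine absurd (hsep _ _ hUper hm hUW)
      (not_subsingleton_of_frontier_subset (hHo h) hh.2 ⟨h, hhH⟩ fun y hy => ?_)
    rw [(hHo h).frontier_eq] at hy
    exact ⟨closure_mono hΔU ((closure_component_subset h hy.1).resolve_left hy.2),
      closure_mono hHW hy.1⟩

/-! ### Irrational rotations -/

/-- The multiplier of the rotation of angle `2πθ`. -/
def rotationMultiplier (θ : ℝ) : ℂ := Complex.exp (2 * Real.pi * θ * Complex.I)

lemma norm_rotationMultiplier (θ : ℝ) : ‖rotationMultiplier θ‖ = 1 := by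
  have h := Complex.norm_exp_ofReal_mul_I (2 * Real.pi * θ)
  push_cast at h
  exact h

lemma rotationMultiplier_ne_zero (θ : ℝ) : rotationMultiplier θ ≠ 0 := Complex.exp_ne_zero _

lemma rotationMultiplier_pow_ne_one {θ : ℝ} (hθ : Irrational θ) {k : ℕ} (hk : k ≠ 0) :
    rotationMultiplier θ ^ k ≠ 1 := by
  intro h
  rw [rotationMultiplier, ← Complex.exp_nat_mul, Complex.exp_eq_one_iff] at h
  obtain ⟨n, hn⟩ := h
  have h1 : (k : ℂ) * θ = n := by
    refine mul_right_cancel₀ Complex.two_pi_I_ne_zero ?_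
    rw [← hn]
    ring
  have h2 : (k : ℝ) * θ = n := by exact_mod_cast h1
  exact (hθ.natCast_mul hk).ne_int n h2

lemma mem_closure_range_rotationMultiplier_pow {θ : ℝ} (hθ : Irrational θ) {w : ℂ}
    (hw : ‖w‖ = 1) : w ∈ closure (range fun n : ℕ => rotationMultiplier θ ^ n) := by
  have hd : DenseRange fun n : ℕ => n • ((θ : ℝ) : UnitAddCircle) :=
    denseRange_zsmul_iff_nsmul.1 (AddCircle.denseRange_zsmul_coe_iff.2 (by rwa [div_one]))
  have hw' : ((Complex.arg w / (2 * Real.pi) : ℝ) : UnitAddCircle) ∈ closure _ := hd _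
  have hc : Continuous fun x : UnitAddCircle => (AddCircle.toCircle x : ℂ) :=
    Continuous.comp (g := fun z : Circle => (z : ℂ)) (by fun_prop) AddCircle.continuous_toCircle
  have h := image_closure_subset_closure_image hc ⟨_, hw', rfl⟩
  convert h using 1
  · congr 1
    rw [← range_comp]
    congr 1
    ext n
    simp only [Function.comp_apply, AddCircle.toCircle_nsmul, AddCircle.toCircle_apply_mk,
      Circle.coe_pow, Circle.coe_exp, rotationMultiplier]
    push_cast
    ring_nf
  · simp only [AddCircle.toCircle_apply_mk, Circle.coe_exp]
    have hpi := Real.pi_ne_zero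
    rw [show 2 * Real.pi / 1 * (Complex.arg w / (2 * Real.pi)) = Complex.arg w by field_simp]
    have := Complex.norm_mul_exp_arg_mul_I w
    rw [hw] at this
    simpa using this.symm

/-- A continuous function that is small along the orbit of an irrational rotation is small on
the disk. -/
lemma norm_le_of_norm_rotationMultiplier_pow_le {θ : ℝ} (hθ : Irrational θ) {g : ℂ → ℂ}
    (hg : DifferentiableOn ℂ g (closedBall 0 1)) {ε : ℝ}
    (h : ∀ n : ℕ, ‖g (rotationMultiplier θ ^ n)‖ ≤ ε) {w : ℂ} (hw : ‖w‖ ≤ 1) : ‖g w‖ ≤ ε := by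
  have hcirc : ∀ z : ℂ, ‖z‖ = 1 → ‖g z‖ ≤ ε := by
    intro z hz
    have hmem := mem_closure_range_rotationMultiplier_pow hθ hz
    rw [mem_closure_iff_nhdsWithin_neBot] at hmem
    have hsub : (range fun n : ℕ => rotationMultiplier θ ^ n) ⊆ closedBall 0 1 := by
      rintro _ ⟨n, rfl⟩
      simp [norm_rotationMultiplier]
    have ht : Tendsto (fun z => ‖g z‖) (𝓝[range fun n : ℕ => rotationMultiplier θ ^ n] z)
        (𝓝 ‖g z‖) :=
      (((hg.continuousOn z (by simp [hz])).mono hsub).norm).tendsto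
    refine le_of_tendsto ht ?_
    filter_upwards [self_mem_nhdsWithin] with y hy
    obtain ⟨n, rfl⟩ := hy
    exact h n
  refine Complex.norm_le_of_forall_mem_frontier_norm_le (U := ball 0 1) isBounded_ball
    ?_ (fun z hz => hcirc z ?_) (z := w) ?_
  · exact DifferentiableOn.diffContOnCl (by rwa [closure_ball _ one_ne_zero])
  · rw [frontier_ball _ one_ne_zero] at hz
    simpa using hz
  · rw [closure_ball _ one_ne_zero]
    simpa using hw

/-- Cesàro means of nontrivial powers of a unimodular number tend to zero. -/
lemma tendsto_cesaro_pow {μ : ℂ} (hμ : ‖μ‖ = 1) (hμ1 : μ ≠ 1) :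
    Tendsto (fun N : ℕ => (N : ℂ)⁻¹ * ∑ n ∈ Finset.range N, μ ^ n) atTop (𝓝 0) := by
  have h0 : 0 < ‖μ - 1‖ := norm_pos_iff.2 (sub_ne_zero.2 hμ1)
  refine squeeze_zero_norm (a := fun N : ℕ => (N : ℝ)⁻¹ * (2 / ‖μ - 1‖)) (fun N => ?_) ?_
  · rw [norm_mul, norm_inv, Complex.norm_natCast, geom_sum_eq hμ1, norm_div]
    gcongr
    calc ‖μ ^ N - 1‖ ≤ ‖μ ^ N‖ + ‖(1 : ℂ)‖ := norm_sub_le _ _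
      _ = 2 := by rw [norm_pow, hμ, one_pow, norm_one]; norm_num
  · simpa using (tendsto_inv_atTop_nhds_zero_nat (𝕜 := ℝ)).mul_const (2 / ‖μ - 1‖)

/-- Projection to the linear Taylor coefficient by averaging over an irrational rotation. -/
lemma eventually_norm_cesaro_sub_lt {θ : ℝ} (hθ : Irrational θ) {φ : ℂ → ℂ}
    (hφ : DifferentiableOn ℂ φ (ball 0 1)) (huc : UniformContinuousOn φ (ball 0 1)) {ε : ℝ}
    (hε : 0 < ε) : ∀ᶠ N : ℕ in atTop, ∀ ζ ∈ ball (0 : ℂ) 1,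
      ‖(N : ℂ)⁻¹ * ∑ n ∈ Finset.range N,
        (rotationMultiplier θ)⁻¹ ^ n * φ (rotationMultiplier θ ^ n * ζ) - deriv φ 0 * ζ‖ < ε := by
  set l := rotationMultiplier θ
  have hl : ‖l‖ = 1 := norm_rotationMultiplier θ
  have hl0 : l ≠ 0 := rotationMultiplier_ne_zero θ
  set c := deriv φ 0
  obtain ⟨δ, hδ, hδφ⟩ := Metric.uniformContinuousOn_iff.1 huc (ε / 4) (by positivity)
  obtain ⟨t, ht0, ht⟩ : ∃ t : ℝ, 0 < t ∧ t < 1 ∧ t < δ ∧ t * ‖c‖ < ε / 4 := by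
    have h : Tendsto (fun t : ℝ => t * ‖c‖) (𝓝[>] 0) (𝓝 0) := by
      have : Continuous fun t : ℝ => t * ‖c‖ := by fun_prop
      simpa using (this.tendsto 0).mono_left nhdsWithin_le_nhds
    have h2 : ∀ b : ℝ, 0 < b → ∀ᶠ t : ℝ in 𝓝[>] 0, t < b :=
      fun b hb => mem_nhdsWithin_of_mem_nhds (Iio_mem_nhds hb)
    exact ((eventually_mem_nhdsWithin (s := Ioi (0 : ℝ))).and ((h2 1 one_pos).and ((h2 δ hδ).and
      (h.eventually_lt_const (by positivity : (0 : ℝ) < ε / 4))))).exists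
  obtain ⟨ht1, htδ, htc⟩ := ht
  set s : ℝ := 1 - t with hs
  have hs0 : 0 < s := by linarith
  have hs1 : s < 1 := by linarith
  obtain ⟨r, hsr, hr1⟩ := exists_between hs1
  have hr0 : 0 < r := hs0.trans hsr
  lift r to NNReal using hr0.le
  lift s to NNReal using hs0.le with s' hs'
  have hsc : (s' : ℂ) = 1 - t := by
    have : ((s' : ℝ) : ℂ) = ((1 - t : ℝ) : ℂ) := congrArg _ hs
    exact this.trans (by push_cast; ring)
  have hp := (hφ.mono (closedBall_subset_ball hr1)).hasFPowerSeriesOnBall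
    (NNReal.coe_pos.1 hr0)
  set p := cauchyPowerSeries φ 0 r
  have hpc : p.coeff 1 = c := by
    have := hp.hasFPowerSeriesAt.deriv
    rw [FormalMultilinearSeries.apply_eq_pow_smul_coeff] at this
    simpa using this.symm
  have hsr' : (s' : ENNReal) < r := by exact_mod_cast hsr
  have hunif := Metric.tendstoUniformlyOn_iff.1 (hp.tendstoUniformlyOn hsr') (ε / 4)
    (by positivity)
  obtain ⟨m, hm, hm1⟩ := (hunif.and (eventually_gt_atTop 1)).exists
  simp only [zero_add] at hm
  set a : ℕ → ℂ := fun k => (s' : ℂ) ^ k * p.coeff k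
  set P : ℂ → ℂ := fun ζ => ∑ k ∈ Finset.range m, a k * ζ ^ k
  have hPφ : ∀ ζ ∈ ball (0 : ℂ) 1, ‖φ ζ - P ζ‖ ≤ ε / 2 := by
    intro ζ hζ
    have hζ1 : ‖ζ‖ < 1 := by simpa using hζ
    have hsζ : ‖(s' : ℂ) * ζ‖ < s' := by
      rw [norm_mul]
      simpa using mul_lt_of_lt_one_right hs0 hζ1
    have h1 := hm ((s' : ℂ) * ζ) (by simpa using hsζ)
    have h2 := hδφ ζ hζ ((s' : ℂ) * ζ) (by simpa using hsζ.trans hs1) (by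
      rw [dist_eq_norm]
      have : ζ - (s' : ℂ) * ζ = (t : ℂ) * ζ := by
        rw [hsc]
        ring
      rw [this, norm_mul, Complex.norm_real, Real.norm_of_nonneg ht0.le]
      nlinarith [norm_nonneg ζ])
    have h3 : p.partialSum m ((s' : ℂ) * ζ) = P ζ := by
      refine Finset.sum_congr rfl fun k _ => ?_
      rw [FormalMultilinearSeries.apply_eq_pow_smul_coeff, smul_eq_mul, mul_pow]
      ring
    rw [h3] at h1
    rw [← dist_eq_norm]
    linarith [dist_triangle (φ ζ) (φ ((s' : ℂ) * ζ)) (P ζ)]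
  set d : ℕ → ℕ → ℂ := fun N k => (N : ℂ)⁻¹ * (∑ n ∈ Finset.range N, (l⁻¹ * l ^ k) ^ n) -
    if k = 1 then 1 else 0
  have hd : ∀ k, Tendsto (fun N => d N k) atTop (𝓝 0) := by
    intro k
    by_cases hk : k = 1
    · refine tendsto_const_nhds.congr' ?_
      filter_upwards [eventually_ne_atTop 0] with N hN
      simp [d, hk, hl0, hN]
    · simp only [d, hk, if_false, sub_zero]
      refine tendsto_cesaro_pow (by simp [hl]) fun h => ?_
      rw [inv_mul_eq_one₀ hl0] at h
      rcases k with _ | k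
      · exact rotationMultiplier_pow_ne_one hθ one_ne_zero (by simpa using h)
      · refine rotationMultiplier_pow_ne_one hθ (k := k) (by lia) ?_
        refine mul_right_cancel₀ hl0 ?_
        rw [one_mul, ← pow_succ]
        exact h.symm
  have hsum : Tendsto (fun N => ∑ k ∈ Finset.range m, ‖a k‖ * ‖d N k‖) atTop (𝓝 0) := by
    have := tendsto_finsetSum (Finset.range m) fun k _ => (hd k).norm.const_mul ‖a k‖
    simpa using this
  filter_upwards [hsum.eventually_lt_const (by positivity : (0 : ℝ) < ε / 4),
    eventually_ne_atTop 0] with N hN hN0 ζ hζ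
  have hζ1 : ‖ζ‖ < 1 := by simpa using hζ
  have hrot : ∀ n : ℕ, l ^ n * ζ ∈ ball (0 : ℂ) 1 := fun n => by simpa [hl] using hζ1
  have hsplit : (N : ℂ)⁻¹ * ∑ n ∈ Finset.range N, l⁻¹ ^ n * φ (l ^ n * ζ) - c * ζ =
      (N : ℂ)⁻¹ * (∑ n ∈ Finset.range N, l⁻¹ ^ n * (φ (l ^ n * ζ) - P (l ^ n * ζ))) +
      (∑ k ∈ Finset.range m, a k * d N k * ζ ^ k) - (t : ℂ) * c * ζ := by
    have hTP : (N : ℂ)⁻¹ * ∑ n ∈ Finset.range N, l⁻¹ ^ n * P (l ^ n * ζ) =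
        ∑ k ∈ Finset.range m, a k * (d N k + if k = 1 then 1 else 0) * ζ ^ k := by
      simp only [P, d, sub_add_cancel, Finset.mul_sum, Finset.sum_mul]
      rw [Finset.sum_comm]
      refine Finset.sum_congr rfl fun k _ => Finset.sum_congr rfl fun n _ => ?_
      rw [mul_pow, mul_pow, ← pow_mul, ← pow_mul, mul_comm n k]
      ring
    have hlin : ∑ k ∈ Finset.range m, a k * (if k = 1 then 1 else 0) * ζ ^ k =
        (1 - t : ℂ) * c * ζ := by
      rw [Finset.sum_eq_single 1]
      · simp only [a, hpc, if_true, pow_one, mul_one, hsc]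
      · intro k _ hk
        simp [hk]
      · intro h
        exact absurd (Finset.mem_range.2 hm1) h
    simp only [mul_add, add_mul, Finset.sum_add_distrib, hlin] at hTP
    simp only [mul_sub, Finset.sum_sub_distrib, hTP]
    ring
  rw [hsplit]
  have e1 : ‖(N : ℂ)⁻¹ * (∑ n ∈ Finset.range N, l⁻¹ ^ n * (φ (l ^ n * ζ) - P (l ^ n * ζ)))‖
      ≤ ε / 2 := by
    rw [norm_mul, norm_inv, Complex.norm_natCast, inv_mul_le_iff₀ (by positivity)]
    refine (norm_sum_le_of_le (Finset.range N) (n := fun _ => ε / 2) fun n _ => ?_).trans_eq ?_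
    · rw [norm_mul, norm_pow, norm_inv, hl, inv_one, one_pow, one_mul]
      exact hPφ _ (hrot n)
    · simp
  have e2 : ‖∑ k ∈ Finset.range m, a k * d N k * ζ ^ k‖ ≤
      ∑ k ∈ Finset.range m, ‖a k‖ * ‖d N k‖ := by
    refine norm_sum_le_of_le _ fun k _ => ?_
    rw [norm_mul, norm_mul, norm_pow]
    exact mul_le_of_le_one_right (by positivity) (pow_le_one₀ (norm_nonneg _) hζ1.le)
  have e3 : ‖(t : ℂ) * c * ζ‖ ≤ t * ‖c‖ := by
    rw [norm_mul, norm_mul, Complex.norm_real, Real.norm_of_nonneg ht0.le]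
    exact mul_le_of_le_one_right (by positivity) hζ1.le
  refine (norm_sub_le _ _).trans_lt ?_
  refine (add_le_add (norm_add_le _ _) le_rfl).trans_lt ?_
  linarith

/-- The derivative of a univalent function does not vanish. -/
lemma deriv_ne_zero_of_injOn {φ : ℂ → ℂ} {U : Set ℂ} (hU : IsOpen U) (hUc : IsPreconnected U)
    (hφ : DifferentiableOn ℂ φ U) (hinj : InjOn φ U) {z : ℂ} (hz : z ∈ U) : deriv φ z ≠ 0 := by
  have han : AnalyticOnNhd ℂ φ U := hφ.analyticOnNhd hU
  have hpunct : ∃ᶠ x in 𝓝 z, x ∈ U ∧ x ≠ z :=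
    ((eventually_mem_nhdsWithin (s := {z}ᶜ)).and
      (mem_nhdsWithin_of_mem_nhds (hU.mem_nhds hz))).frequently.filter_mono
        nhdsWithin_le_nhds |>.mono fun x hx => ⟨hx.2, hx.1⟩
  have hopen : ∀ s ⊆ U, IsOpen s → IsOpen (φ '' s) := by
    refine (han.is_constant_or_isOpen hUc).resolve_left ?_
    rintro ⟨w, hw⟩
    obtain ⟨x, hxU, hxz⟩ := hpunct.exists
    exact hxz (hinj hxU hz ((hw x hxU).trans (hw z hz).symm))
  set ψ := Function.invFunOn φ U
  have hψ : ∀ x ∈ U, ψ (φ x) = x := fun x hx => hinj.leftInvOn_invFunOn hx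
  have himg : ∀ x ∈ U, ∀ N ∈ 𝓝 x, φ '' (N ∩ U) ∈ 𝓝 (φ x) := by
    intro x hx N hN
    obtain ⟨s, hs, hso, hxs⟩ := _root_.mem_nhds_iff.1 hN
    exact mem_of_superset ((hopen (s ∩ U) inter_subset_right (hso.inter hU)).mem_nhds
      ⟨x, ⟨hxs, hx⟩, rfl⟩) (image_mono (inter_subset_inter_left _ hs))
  have hψc : ∀ x ∈ U, ContinuousAt ψ (φ x) := by
    intro x hx N hN
    rw [hψ x hx] at hN
    refine Filter.mem_map.2 (mem_of_superset (himg x hx N hN) ?_)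
    rintro _ ⟨w, ⟨hwN, hwU⟩, rfl⟩
    simpa [hψ w hwU] using hwN
  have hderiv : ∀ x ∈ U, HasDerivAt φ (deriv φ x) x :=
    fun x hx => (hφ.differentiableAt (hU.mem_nhds hx)).hasDerivAt
  have hψd : ∀ x ∈ U, deriv φ x ≠ 0 → DifferentiableAt ℂ ψ (φ x) := by
    intro x hx hx0
    refine (HasDerivAt.of_local_left_inverse (hψc x hx) (f := φ) (f' := deriv φ x) ?_ hx0
      ?_).differentiableAt
    · rw [hψ x hx]
      exact hderiv x hx
    · refine mem_of_superset (himg x hx univ univ_mem) ?_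
      rintro _ ⟨w, ⟨-, hwU⟩, rfl⟩
      exact congrArg φ (hψ w hwU)
  have hne : ∀ᶠ x in 𝓝[≠] z, deriv φ x ≠ 0 := by
    refine (han.deriv z hz).eventually_eq_zero_or_eventually_ne_zero.resolve_left fun h0 => ?_
    obtain ⟨r, hr, hball⟩ := Metric.mem_nhds_iff.1 (h0.and (hU.mem_nhds hz))
    obtain ⟨x, hx, hxU, hxz⟩ := (hpunct.and_eventually (ball_mem_nhds z hr)).exists.imp
      fun x hx => (⟨hx.2, hx.1.1, hx.1.2⟩ : x ∈ ball z r ∧ x ∈ U ∧ x ≠ z)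
    refine hxz (hinj hxU hz ?_)
    exact isOpen_ball.is_const_of_deriv_eq_zero (convex_ball z r).isPreconnected
      (hφ.mono fun w hw => (hball hw).2) (fun w hw => (hball hw).1) hx (mem_ball_self hr)
  have hψz : DifferentiableAt ℂ ψ (φ z) := by
    refine (Complex.analyticAt_of_differentiable_on_punctured_nhds_of_continuousAt ?_
      (hψc z hz)).differentiableAt
    rw [eventually_nhdsWithin_iff] at hne ⊢
    refine mem_of_superset (himg z hz _ hne) ?_
    rintro _ ⟨w, ⟨hw, hwU⟩, rfl⟩ hwz
    exact hψd w hwU (hw fun h => hwz (congrArg φ h))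
  intro h0
  have hcomp := hψz.hasDerivAt.comp z (hderiv z hz)
  have hid : HasDerivAt (ψ ∘ φ) 1 z :=
    (hasDerivAt_id z).congr_of_eventuallyEq (by
      filter_upwards [hU.mem_nhds hz] with w hw using hψ w hw)
  have := hcomp.unique hid
  simp [h0] at this

section SiegelDisk

variable {f φ : ℂ → ℂ} {Δ : Set ℂ} {θ : ℝ}

lemma iterate_linearization
    (hrot : ∀ z ∈ ball (0 : ℂ) 1, f (φ z) = φ (rotationMultiplier θ * z)) (n : ℕ) {z : ℂ}
    (hz : z ∈ ball (0 : ℂ) 1) : f^[n] (φ z) = φ (rotationMultiplier θ ^ n * z) := by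
  induction n with
  | zero => simp
  | succ n ih =>
    rw [Function.iterate_succ_apply', ih, hrot, pow_succ']
    · ring_nf
    · simpa [norm_rotationMultiplier] using hz

/-- If the iterates are equicontinuous at a boundary point of a rotation domain, then the
linearizing map is uniformly continuous. -/
lemma uniformContinuousOn_linearization (hθ : Irrational θ) (hΔo : IsOpen Δ)
    (hφ : DifferentiableOn ℂ φ (ball 0 1)) (himg : φ '' ball 0 1 = Δ)
    (hrot : ∀ z ∈ ball (0 : ℂ) 1, f (φ z) = φ (rotationMultiplier θ * z)) {p : ℂ}
    (hp : p ∈ frontier Δ) (heq : EquicontinuousAt (fun n : ℕ => f^[n]) p) :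
    UniformContinuousOn φ (ball 0 1) := by
  rw [hΔo.frontier_eq] at hp
  refine Metric.uniformContinuousOn_iff.2 fun ε hε => ?_
  have hN := Metric.equicontinuousAt_iff_right.1 heq (ε / 10) (by positivity)
  have hfar : ∀ t < 1, ∃ ξ ∈ ball (0 : ℂ) 1, t < ‖ξ‖ ∧
      ∀ n, dist (f^[n] p) (f^[n] (φ ξ)) < ε / 10 := by
    intro t ht
    have hcl : IsClosed (φ '' closedBall 0 t) := ((isCompact_closedBall 0 t).image_of_continuousOn
      (hφ.continuousOn.mono (closedBall_subset_ball ht))).isClosed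
    have hpt : p ∉ φ '' closedBall 0 t := fun h =>
      hp.2 (himg ▸ image_mono (closedBall_subset_ball ht) h)
    obtain ⟨_, ⟨h1, h2⟩, h3⟩ := mem_closure_iff_nhds.1 hp.1 _
      (inter_mem hN (hcl.isOpen_compl.mem_nhds hpt))
    obtain ⟨ξ, hξ, rfl⟩ := himg.symm.subset h3
    refine ⟨ξ, hξ, ?_, h1⟩
    by_contra! h
    exact h2 ⟨ξ, by simpa using h, rfl⟩
  obtain ⟨ζ, hζ, -, hζN⟩ := hfar 0 one_pos
  have hmaps : ∀ ξ ∈ ball (0 : ℂ) 1, MapsTo (fun w => w * ξ) (closedBall 0 1) (ball 0 1) := by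
    intro ξ hξ w hw
    rw [mem_closedBall_zero_iff] at hw
    rw [mem_ball_zero_iff] at hξ ⊢
    rw [norm_mul]
    exact (mul_le_of_le_one_left (norm_nonneg _) hw).trans_lt hξ
  have hdiff : ∀ ξ ∈ ball (0 : ℂ) 1,
      DifferentiableOn ℂ (fun w => φ (w * ξ)) (closedBall 0 1) := fun ξ hξ =>
    hφ.comp (by fun_prop) (hmaps ξ hξ)
  have hclose : ∀ ξ ∈ ball (0 : ℂ) 1, (∀ n, dist (f^[n] p) (f^[n] (φ ξ)) < ε / 10) →
      ∀ w : ℂ, ‖w‖ ≤ 1 → dist (φ (w * ζ)) (φ (w * ξ)) ≤ ε / 5 := by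
    intro ξ hξ hξN w hw
    rw [dist_eq_norm]
    refine norm_le_of_norm_rotationMultiplier_pow_le hθ ((hdiff ζ hζ).sub (hdiff ξ hξ))
      (fun n => ?_) hw
    rw [Pi.sub_apply, ← iterate_linearization hrot n hζ, ← iterate_linearization hrot n hξ,
      ← dist_eq_norm]
    linarith [dist_triangle_left (f^[n] (φ ζ)) (f^[n] (φ ξ)) (f^[n] p), hζN n, hξN n]
  obtain ⟨δ, hδ, hδφ⟩ := Metric.uniformContinuousOn_iff.1
    ((isCompact_closedBall (0 : ℂ) 1).uniformContinuousOn_of_continuous (hdiff ζ hζ).continuousOn)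
    (ε / 5) (by positivity)
  refine ⟨δ / 2, by positivity, fun a ha b hb hab => ?_⟩
  rw [mem_ball_zero_iff] at ha hb
  obtain ⟨ξ, hξ, hξt, hξN⟩ := hfar (max (1 / 2) (max ‖a‖ ‖b‖))
    (max_lt (by norm_num) (max_lt ha hb))
  obtain ⟨h2, h3⟩ := max_lt_iff.1 hξt
  obtain ⟨ha', hb'⟩ := max_lt_iff.1 h3
  have hξ0 : ξ ≠ 0 := norm_pos_iff.1 (by linarith)
  have hle : ∀ x : ℂ, ‖x‖ < ‖ξ‖ → ‖x / ξ‖ ≤ 1 := fun x hx => by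
    rw [norm_div]
    exact div_le_one_of_le₀ hx.le (norm_nonneg _)
  have hA := hclose ξ hξ hξN (a / ξ) (hle a ha')
  have hB := hclose ξ hξ hξN (b / ξ) (hle b hb')
  rw [div_mul_cancel₀ _ hξ0] at hA hB
  have hAB := hδφ (a / ξ) (by simpa using hle a ha') (b / ξ) (by simpa using hle b hb') (by
    rw [dist_eq_norm, ← sub_div, norm_div, ← dist_eq_norm,
      div_lt_iff₀ (by linarith : 0 < ‖ξ‖)]
    nlinarith)
  linarith [dist_triangle_left (φ a) (φ b) (φ (a / ξ * ζ)),
    dist_triangle (φ (a / ξ * ζ)) (φ (b / ξ * ζ)) (φ b)]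

/-- The inverse of a uniformly continuous linearizing map is a uniform limit of entire maps. -/
lemma exists_differentiable_norm_sub_lt (hf : Differentiable ℂ f) (hθ : Irrational θ)
    (hφ : DifferentiableOn ℂ φ (ball 0 1)) (hinj : InjOn φ (ball 0 1))
    (hrot : ∀ z ∈ ball (0 : ℂ) 1, f (φ z) = φ (rotationMultiplier θ * z))
    (huc : UniformContinuousOn φ (ball 0 1)) {ε : ℝ} (hε : 0 < ε) :
    ∃ e : ℂ → ℂ, Differentiable ℂ e ∧ ∀ ζ ∈ ball (0 : ℂ) 1, ‖e (φ ζ) - ζ‖ < ε := by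
  have hc : deriv φ 0 ≠ 0 := deriv_ne_zero_of_injOn isOpen_ball (convex_ball 0 1).isPreconnected
    hφ hinj (mem_ball_self one_pos)
  obtain ⟨N, hN⟩ := (eventually_norm_cesaro_sub_lt hθ hφ huc
    (mul_pos (norm_pos_iff.2 hc) hε)).exists
  refine ⟨fun x => (deriv φ 0)⁻¹ * ((N : ℂ)⁻¹ * ∑ n ∈ Finset.range N,
    (rotationMultiplier θ)⁻¹ ^ n * f^[n] x), ?_, fun ζ hζ => ?_⟩
  · exact ((Differentiable.fun_sum fun n _ => (hf.iterate n).const_mul _).const_mul _).const_mul _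
  · have h := hN ζ hζ
    simp only [iterate_linearization hrot _ hζ]
    set A := (N : ℂ)⁻¹ * ∑ n ∈ Finset.range N,
      (rotationMultiplier θ)⁻¹ ^ n * φ (rotationMultiplier θ ^ n * ζ)
    have : (deriv φ 0)⁻¹ * A - ζ = (deriv φ 0)⁻¹ * (A - deriv φ 0 * ζ) := by
      rw [mul_sub, inv_mul_cancel_left₀ hc]
    rw [this, norm_mul, norm_inv, inv_mul_lt_iff₀ (norm_pos_iff.2 hc)]
    exact h

/-- A holomorphic estimate on a set extends to its hidden points. -/
lemma IsHidden.norm_le {X V : Set ℂ} {g : ℂ → ℂ} {C : ℝ} {z : ℂ} (hz : IsHidden X z)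
    (hg : DifferentiableOn ℂ g V) (hV : IsOpen V) (hXV : closure X ⊆ V)
    (hHV : connectedComponentIn (closure X)ᶜ z ⊆ V) (hC : ∀ x ∈ X, ‖g x‖ ≤ C) : ‖g z‖ ≤ C := by
  have hcl : ∀ x ∈ closure X, ‖g x‖ ≤ C := by
    intro x hx
    have hx' := mem_closure_iff_nhdsWithin_neBot.1 hx
    have ht : Tendsto (fun y => ‖g y‖) (𝓝[X] x) (𝓝 ‖g x‖) :=
      ((hg.continuousOn.continuousAt (hV.mem_nhds (hXV hx))).norm.tendsto).mono_left
        nhdsWithin_le_nhds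
    exact le_of_tendsto ht (eventually_mem_nhdsWithin.mono hC)
  have hsub := closure_component_subset (X := X) z
  refine Complex.norm_le_of_forall_mem_frontier_norm_le hz.2
    (DifferentiableOn.diffContOnCl (hg.mono (hsub.trans (union_subset hHV hXV))))
    (fun x hx => hcl x ?_) (subset_closure (mem_connectedComponentIn hz.1))
  rw [isClosed_closure.isOpen_compl.connectedComponentIn.frontier_eq] at hx
  exact (hsub hx.1).resolve_left hx.2

/-- A Siegel disk with uniformly continuous linearizing map has no hidden components. -/
lemma not_isHidden_of_uniformContinuousOn (hf : Differentiable ℂ f) (hθ : Irrational θ)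
    (hφ : DifferentiableOn ℂ φ (ball 0 1)) (hinj : InjOn φ (ball 0 1))
    (himg : φ '' ball 0 1 = Δ)
    (hrot : ∀ z ∈ ball (0 : ℂ) 1, f (φ z) = φ (rotationMultiplier θ * z))
    (huc : UniformContinuousOn φ (ball 0 1)) (z : ℂ) : ¬ IsHidden Δ z := by
  intro hz
  refine hz.1 (Metric.mem_closure_iff.2 fun η hη => ?_)
  obtain ⟨δ, hδ, hδφ⟩ := Metric.uniformContinuousOn_iff.1 huc (η / 2) (by positivity)
  obtain ⟨κ, hκ0, hκ⟩ := exists_between (lt_min (half_pos hδ) one_pos)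
  obtain ⟨hκδ, hκ1⟩ := lt_min_iff.1 hκ
  obtain ⟨e, he, heφ⟩ := exists_differentiable_norm_sub_lt hf hθ hφ hinj hrot huc hκ0
  have hs0 : 0 < 1 - κ := by linarith
  have hs : ‖(1 - κ : ℂ)‖ = 1 - κ := by
    rw [← Complex.ofReal_one, ← Complex.ofReal_sub, Complex.norm_real, Real.norm_of_nonneg hs0.le]
  have hge : Differentiable ℂ fun x => (1 - κ : ℂ) * e x := he.const_mul _
  have hlt : (1 - κ) * (1 + κ) < 1 := by nlinarith
  have hbd : ∀ x ∈ Δ, ‖(1 - κ : ℂ) * e x‖ ≤ (1 - κ) * (1 + κ) := by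
    rw [← himg]
    rintro _ ⟨ζ, hζ, rfl⟩
    rw [norm_mul, hs]
    gcongr
    have := norm_add_le (e (φ ζ) - ζ) ζ
    rw [sub_add_cancel] at this
    linarith [heφ ζ hζ, mem_ball_zero_iff.1 hζ]
  set V := {x | ‖(1 - κ : ℂ) * e x‖ < 1} with hVdef
  have hV : IsOpen V := isOpen_lt hge.continuous.norm continuous_const
  have hXV : closure Δ ⊆ V := fun x hx => by
    refine (closure_minimal (t := {x | ‖(1 - κ : ℂ) * e x‖ ≤ (1 - κ) * (1 + κ)}) hbd
      (isClosed_le hge.continuous.norm continuous_const) hx).trans_lt hlt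
  have hHV : connectedComponentIn (closure Δ)ᶜ z ⊆ V := fun x hx =>
    ((hz.of_mem hx).norm_le hge.differentiableOn isOpen_univ (subset_univ _) (subset_univ _)
      hbd).trans_lt hlt
  have hVball : MapsTo (fun x => (1 - κ : ℂ) * e x) V (ball 0 1) := fun x hx =>
    mem_ball_zero_iff.2 hx
  have hzV : z ∈ V := hHV (mem_connectedComponentIn hz.1)
  have hR : DifferentiableOn ℂ (fun x => x - φ ((1 - κ : ℂ) * e x)) V :=
    differentiableOn_id.sub (hφ.comp hge.differentiableOn hVball)
  refine ⟨φ ((1 - κ : ℂ) * e z), himg ▸ ⟨_, hVball hzV, rfl⟩, ?_⟩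
  rw [dist_eq_norm]
  refine (hz.norm_le hR hV hXV hHV (C := η / 2) fun x hx => ?_).trans_lt (by linarith)
  obtain ⟨ζ, hζ, rfl⟩ := himg.symm.subset hx
  rw [← dist_eq_norm]
  refine (hδφ ζ hζ _ (hVball (hXV (subset_closure hx))) ?_).le
  rw [dist_comm, dist_eq_norm]
  have : (1 - κ : ℂ) * e (φ ζ) - ζ = (1 - κ : ℂ) * (e (φ ζ) - ζ) - κ * ζ := by ring
  rw [this]
  refine (norm_sub_le _ _).trans_lt ?_
  rw [norm_mul, norm_mul, hs, Complex.norm_real, Real.norm_of_nonneg hκ0.le]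
  have h1 := heφ ζ hζ
  have h2 := mem_ball_zero_iff.1 hζ
  nlinarith [norm_nonneg ζ, norm_nonneg (e (φ ζ) - ζ)]

end SiegelDisk

/-- Proposition A(b): no wandering domains, Separation Property and no
singular values in `Δ̂` imply `Δ` has no hidden components. -/
theorem stmt13 (f : ℂ → ℂ) (hf : Differentiable ℂ f)
    (hnw : ¬ ∃ U : Set ℂ, IsWanderingDomain f U)
    (hsep : SeparationProperty f) (Δ : Set ℂ) (θ : ℝ)
    (hΔ : IsSiegelDisk f Δ θ) (hb : IsBounded Δ)
    (hs : {s | IsSingularValue f s} ∩ hat Δ = ∅) :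
    ∀ z ∉ closure Δ, ¬ IsBounded (connectedComponentIn (closure Δ)ᶜ z) := by
  obtain ⟨hΔo, hΔc, hfΔ, hΔF, hθ, φ, ⟨hφ, hinj, himg⟩, hrot⟩ := hΔ
  intro z hz hzb
  obtain ⟨p, hpF, hp⟩ := exists_frontier_mem_fatouSet hf hnw hsep hΔo hΔc hfΔ hΔF hb hs ⟨hz, hzb⟩
  have huc := uniformContinuousOn_linearization hθ hΔo hφ himg hrot hp
    (mem_fatouSet_iff.1 hpF).self_of_nhds
  exact not_isHidden_of_uniformContinuousOn hf hθ hφ hinj himg hrot huc z ⟨hz, hzb⟩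
end
end
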